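/- arXiv:math/0603275 — 2 statements merged into one kernel-verified Lean document; each statement's English description precedes it below -/
import Mathlib

section
/- (Riemann–von Mangoldt formula) For T > 0 let N(T) denote the number of nontrivial zeros ρ of the Riemann zeta function with 0 < Im ρ ≤ T, counted with multiplicity m_ρ (this is a finite sum). Then there exist constants C > 0 and T₀ ≥ 2 such that for all T ≥ T₀: |N(T) − ((T/(2π))·log(T/(2π)) − T/(2π))| ≤ C·log T. -/
open Real

/-- The multiplicity (order of vanishing) of the Riemann zeta function at a point `ρ`:
the least `n` such that the `n`-th derivative of `ζ` at `ρ` is nonzero. -/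
noncomputable def zetaZeroMultiplicity (ρ : ℂ) : ℕ :=
  sInf {n : ℕ | iteratedDeriv n riemannZeta ρ ≠ 0}

open Filter Topology
open Complex (I)

/-- `LogChange f z w δ` says that `f` has a continuous logarithm along the segment from `z` to `w`,
and that this logarithm changes by `δ` from `z` to `w`. -/
def LogChange (f : ℂ → ℂ) (z w δ : ℂ) : Prop :=
  ∃ L : ℝ → ℂ, ContinuousOn L (Set.Icc 0 1) ∧
    (∀ t ∈ Set.Icc (0 : ℝ) 1, f (z + t * (w - z)) = Complex.exp (L t)) ∧ L 1 - L 0 = δ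

namespace LogChange

variable {f g : ℂ → ℂ} {z w δ ε : ℂ}

lemma mul (hf : LogChange f z w δ) (hg : LogChange g z w ε) :
    LogChange (fun s ↦ f s * g s) z w (δ + ε) := by
  obtain ⟨L, hL, hLf, rfl⟩ := hf
  obtain ⟨M, hM, hMg, rfl⟩ := hg
  refine ⟨fun t ↦ L t + M t, hL.add hM, fun t ht ↦ ?_, by ring⟩
  simp only [hLf t ht, hMg t ht, Complex.exp_add]

lemma pow (hf : LogChange f z w δ) (n : ℕ) : LogChange (fun s ↦ f s ^ n) z w (n * δ) := by
  obtain ⟨L, hL, hLf, rfl⟩ := hf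
  refine ⟨fun t ↦ n * L t, continuousOn_const.mul hL, fun t ht ↦ ?_, by ring⟩
  simp only [hLf t ht, Complex.exp_nat_mul]

lemma prod {ι : Type*} (S : Finset ι) {F : ι → ℂ → ℂ} {d : ι → ℂ}
    (h : ∀ i ∈ S, LogChange (F i) z w (d i)) :
    LogChange (fun s ↦ ∏ i ∈ S, F i s) z w (∑ i ∈ S, d i) := by
  choose! L hL hLf hd using h
  refine ⟨fun t ↦ ∑ i ∈ S, L i t, continuousOn_finsetSum _ hL, fun t ht ↦ ?_, ?_⟩
  · rw [Complex.exp_sum]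
    exact Finset.prod_congr rfl fun i hi ↦ hLf i hi t ht
  · rw [← Finset.sum_sub_distrib]
    exact Finset.sum_congr rfl hd

lemma congr (hf : LogChange f z w δ)
    (h : ∀ t ∈ Set.Icc (0 : ℝ) 1, g (z + t * (w - z)) = f (z + t * (w - z))) :
    LogChange g z w δ := by
  obtain ⟨L, hL, hLf, hd⟩ := hf
  exact ⟨L, hL, fun t ht ↦ (h t ht).trans (hLf t ht), hd⟩

lemma unique (hf : LogChange f z w δ) (hf' : LogChange f z w ε) : δ = ε := by
  obtain ⟨L, hL, hLf, rfl⟩ := hf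
  obtain ⟨M, hM, hMf, rfl⟩ := hf'
  have key : ∀ t ∈ Set.Icc (0 : ℝ) 1, ∃ n : ℤ, L t = M t + n * (2 * π * I) := fun t ht ↦
    Complex.exp_eq_exp_iff_exists_int.1 ((hLf t ht).symm.trans (hMf t ht))
  choose! n hn using key
  have hcont : ContinuousOn (fun t ↦ (n t : ℝ)) (Set.Icc (0 : ℝ) 1) := by
    have h1 : ContinuousOn (fun t ↦ ((L t - M t) / (2 * π * I)).re) (Set.Icc (0 : ℝ) 1) :=
      Complex.continuous_re.comp_continuousOn ((hL.sub hM).div_const _)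
    refine h1.congr fun t ht ↦ ?_
    have : (L t - M t) / (2 * π * I) = (n t : ℂ) := by
      rw [hn t ht, add_sub_cancel_left, mul_div_cancel_right₀ _ Complex.two_pi_I_ne_zero]
    simp only [this, Complex.intCast_re]
  have hconst : n 1 = n 0 := by
    have hc : ContinuousOn n (Set.Icc (0 : ℝ) 1) :=
      Int.isClosedEmbedding_coe_real.isEmbedding.continuousOn_iff.2 hcont
    exact isPreconnected_Icc.constant hc (by simp) (by simp)
  rw [hn 1 (by simp), hn 0 (by simp), hconst]
  ring

/-- A function with a continuous logarithm `h` on the segment. -/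
lemma of_exp {h : ℂ → ℂ} (hc : ContinuousOn h (segment ℝ z w))
    (hf : ∀ s ∈ segment ℝ z w, f s = Complex.exp (h s)) : LogChange f z w (h w - h z) := by
  have hmaps : ∀ t ∈ Set.Icc (0 : ℝ) 1, z + t * (w - z) ∈ segment ℝ z w := fun t ht ↦ by
    rw [segment_eq_image']
    exact ⟨t, ht, by simp⟩
  refine ⟨fun t ↦ h (z + t * (w - z)), hc.comp (by fun_prop) hmaps,
    fun t ht ↦ hf _ (hmaps t ht), by simp⟩

lemma of_slitPlane (hc : ContinuousOn f (segment ℝ z w))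
    (hf : ∀ s ∈ segment ℝ z w, f s ∈ Complex.slitPlane) :
    LogChange f z w (Complex.log (f w) - Complex.log (f z)) :=
  of_exp (hc.clog hf) fun s hs ↦ (Complex.exp_log (Complex.slitPlane_ne_zero (hf s hs))).symm

lemma comp_one_sub (h : LogChange f z w δ) :
    LogChange (fun s ↦ f (1 - s)) (1 - z) (1 - w) δ := by
  obtain ⟨L, hL, hLf, hd⟩ := h
  refine ⟨L, hL, fun t ht ↦ ?_, hd⟩
  rw [← hLf t ht]
  ring_nf

lemma symm (h : LogChange f z w δ) : LogChange f w z (-δ) := by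
  obtain ⟨L, hL, hLf, hd⟩ := h
  refine ⟨fun t ↦ L (1 - t), hL.comp (by fun_prop) fun t ht ↦ ⟨by linarith [ht.2], by linarith [ht.1]⟩,
    fun t ht ↦ ?_, by simp [← hd]⟩
  rw [← hLf (1 - t) ⟨by linarith [ht.2], by linarith [ht.1]⟩]
  push_cast
  ring_nf

/-- Logarithmic change of a linear factor along a segment in an open half-plane whose boundary
passes through the zero; `u` is a normal to the half-plane. -/
lemma sub_const {ρ u : ℂ} (hz : 0 < ((z - ρ) * u).re) (hw : 0 < ((w - ρ) * u).re) :
    LogChange (fun s ↦ s - ρ) z w (Complex.log ((w - ρ) * u) - Complex.log ((z - ρ) * u)) := by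
  have hu : u ≠ 0 := by rintro rfl; simp at hz
  have h1 : LogChange (fun s ↦ (s - ρ) * u) z w
      (Complex.log ((w - ρ) * u) - Complex.log ((z - ρ) * u)) := by
    refine of_slitPlane (f := fun s ↦ (s - ρ) * u) (by fun_prop) fun s hs ↦ Or.inl ?_
    obtain ⟨a, b, ha, hb, hab, rfl⟩ := hs
    have : (a • z + b • w - ρ) * u = a * ((z - ρ) * u) + b * ((w - ρ) * u) := by
      have : (a : ℂ) = 1 - b := by rw [← Complex.ofReal_one, ← hab]; push_cast; ring
      simp only [Complex.real_smul, this]; ring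
    rw [this, Complex.add_re, Complex.re_ofReal_mul, Complex.re_ofReal_mul]
    rcases ha.eq_or_lt with rfl | ha
    · have : b = 1 := by linarith
      rw [this]
      simpa only [zero_mul, one_mul, zero_add] using hw
    · positivity
  have h2 : LogChange (fun _ ↦ u⁻¹) z w 0 := by
    have := of_exp (f := fun _ ↦ u⁻¹) (z := z) (w := w) (h := fun _ ↦ Complex.log u⁻¹)
      continuousOn_const fun s hs ↦ (Complex.exp_log (inv_ne_zero hu)).symm
    simpa using this
  have h3 := h1.mul h2
  rw [add_zero] at h3
  refine h3.congr fun t ht ↦ ?_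
  field_simp

lemma abs_log_sub_log_im_le {a b : ℂ} (ha : 0 < a.re) (hb : 0 < b.re) :
    |(Complex.log a - Complex.log b).im| ≤ π := by
  have h1 := (Complex.abs_arg_le_pi_div_two_iff).2 ha.le
  have h2 := (Complex.abs_arg_le_pi_div_two_iff).2 hb.le
  rw [Complex.sub_im, Complex.log_im, Complex.log_im]
  rw [abs_le] at *
  constructor <;> linarith

/-- A function with values in the right half-plane has argument change at most `π`. -/
lemma exists_of_re_pos (hc : ContinuousOn f (segment ℝ z w))
    (hf : ∀ s ∈ segment ℝ z w, 0 < (f s).re) : ∃ δ, LogChange f z w δ ∧ |δ.im| ≤ π :=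
  ⟨_, of_slitPlane hc fun s hs ↦ Or.inl (hf s hs), abs_log_sub_log_im_le
    (hf w (right_mem_segment _ _ _)) (hf z (left_mem_segment _ _ _))⟩

lemma exists_sub_const {ρ u : ℂ} (hz : 0 < ((z - ρ) * u).re) (hw : 0 < ((w - ρ) * u).re) :
    ∃ δ, LogChange (fun s ↦ s - ρ) z w δ ∧ |δ.im| ≤ π :=
  ⟨_, sub_const hz hw, abs_log_sub_log_im_le hw hz⟩

end LogChange

lemma Differentiable.analyticOrderAt_ne_top {f : ℂ → ℂ} (hf : Differentiable ℂ f) {x : ℂ}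
    (hx : f x ≠ 0) (ρ : ℂ) : analyticOrderAt f ρ ≠ ⊤ := by
  have hA : AnalyticOnNhd ℂ f Set.univ := fun z _ ↦ hf.analyticAt z
  refine AnalyticOnNhd.analyticOrderAt_ne_top_of_isPreconnected hA isPreconnected_univ
    (Set.mem_univ x) (Set.mem_univ ρ) ?_
  rw [(hf.analyticAt x).analyticOrderAt_eq_zero.2 hx]
  simp

/-- Dividing an entire function by the right power of `z - ρ`. -/
lemma Differentiable.exists_eq_sub_pow_mul {f : ℂ → ℂ} (hf : Differentiable ℂ f) {x : ℂ}
    (hx : f x ≠ 0) (ρ : ℂ) : ∃ g : ℂ → ℂ, Differentiable ℂ g ∧ g ρ ≠ 0 ∧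
      ∀ z, f z = (z - ρ) ^ analyticOrderNatAt f ρ * g z := by
  obtain ⟨h, hh, hρ, he⟩ := ((hf.analyticAt ρ).analyticOrderNatAt_eq_iff
    (hf.analyticOrderAt_ne_top hx ρ) (n := analyticOrderNatAt f ρ)).1 rfl
  set m := analyticOrderNatAt f ρ
  have hne : ∀ z, z ≠ ρ → Function.update (fun z ↦ f z / (z - ρ) ^ m) ρ (h ρ) z
      = f z / (z - ρ) ^ m := fun z hz ↦ Function.update_of_ne hz _ _
  refine ⟨Function.update (fun z ↦ f z / (z - ρ) ^ m) ρ (h ρ), fun z ↦ ?_, by simpa, fun z ↦ ?_⟩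
  · rcases eq_or_ne z ρ with rfl | hz
    · refine hh.differentiableAt.congr_of_eventuallyEq ?_
      filter_upwards [he] with w hw
      rcases eq_or_ne w z with rfl | hwz
      · simp
      · rw [hne w hwz, hw, smul_eq_mul, mul_div_cancel_left₀]
        exact pow_ne_zero _ (sub_ne_zero.2 hwz)
    · have : DifferentiableAt ℂ (fun z ↦ f z / (z - ρ) ^ m) z :=
        (hf z).fun_div (by fun_prop) (pow_ne_zero _ (sub_ne_zero.2 hz))
      refine this.congr_of_eventuallyEq ?_
      filter_upwards [isOpen_ne.mem_nhds hz] with w hw using hne w hw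
  · rcases eq_or_ne z ρ with rfl | hz
    · have := he.self_of_nhds
      simpa using this
    · rw [hne z hz, mul_div_cancel₀]
      exact pow_ne_zero _ (sub_ne_zero.2 hz)

/-- Dividing an entire function by the polynomial with prescribed finite set of zeros. -/
lemma Differentiable.exists_eq_prod_sub_pow_mul {f : ℂ → ℂ} (hf : Differentiable ℂ f) {x : ℂ}
    (hx : f x ≠ 0) (S : Finset ℂ) : ∃ g : ℂ → ℂ, Differentiable ℂ g ∧ (∀ ρ ∈ S, g ρ ≠ 0) ∧
      ∀ z, f z = (∏ ρ ∈ S, (z - ρ) ^ analyticOrderNatAt f ρ) * g z := by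
  classical
  induction S using Finset.induction_on with
  | empty => exact ⟨f, hf, by simp, by simp⟩
  | insert ρ S hρ ih =>
    obtain ⟨g, hg, hgS, hfg⟩ := ih
    have hgx : g x ≠ 0 := fun h ↦ hx (by rw [hfg x, h, mul_zero])
    obtain ⟨k, hk, hkρ, hgk⟩ := hg.exists_eq_sub_pow_mul hgx ρ
    set P : ℂ → ℂ := fun z ↦ ∏ ρ ∈ S, (z - ρ) ^ analyticOrderNatAt f ρ
    have hP : Differentiable ℂ P := by fun_prop
    have hPρ : P ρ ≠ 0 := Finset.prod_ne_zero_iff.2 fun σ hσ ↦ pow_ne_zero _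
      (sub_ne_zero.2 fun h ↦ hρ (h ▸ hσ))
    have hord : analyticOrderNatAt f ρ = analyticOrderNatAt g ρ := by
      have hfP : f = P * g := funext hfg
      rw [hfP, analyticOrderNatAt_mul (hP.analyticAt ρ) (hg.analyticAt ρ)
        (hP.analyticOrderAt_ne_top hPρ ρ) (hg.analyticOrderAt_ne_top hgx ρ)]
      simp [analyticOrderNatAt, (hP.analyticAt ρ).analyticOrderAt_eq_zero.2 hPρ]
    refine ⟨k, hk, ?_, fun z ↦ ?_⟩
    · rintro σ hσ hk0
      rcases Finset.mem_insert.1 hσ with rfl | hσ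
      · exact hkρ hk0
      · exact hgS σ hσ (by rw [hgk σ, hk0, mul_zero])
    · rw [hfg z, hgk z, Finset.prod_insert hρ, hord]
      ring

/-- A zero-free holomorphic function on a disc has a holomorphic logarithm. -/
lemma Differentiable.exists_exp_eq_of_ball {g : ℂ → ℂ} (hg : Differentiable ℂ g) {c : ℂ} {r : ℝ}
    (hr : 0 < r) (h0 : ∀ z ∈ Metric.ball c r, g z ≠ 0) :
    ∃ h : ℂ → ℂ, DifferentiableOn ℂ h (Metric.ball c r) ∧ h c = 0 ∧
      ∀ z ∈ Metric.ball c r, g z = g c * Complex.exp (h z) := by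
  have hd : DifferentiableOn ℂ (fun z ↦ _root_.deriv g z / g z) (Metric.ball c r) :=
    (hg.deriv.differentiableOn).fun_div hg.differentiableOn h0
  obtain ⟨h, hc, hh⟩ := hd.isExactOn_ball.with_val_at c 0
  refine ⟨h, fun z hz ↦ (hh z hz).differentiableAt.differentiableWithinAt, hc, fun z hz ↦ ?_⟩
  have hderiv : ∀ w ∈ Metric.ball c r, HasDerivAt (fun w ↦ g w * Complex.exp (-h w)) 0 w := by
    intro w hw
    have := (hg w).hasDerivAt.mul ((hh w hw).fun_neg.cexp)
    have hw0 := h0 w hw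
    have h0 : _root_.deriv g w * Complex.exp (-h w)
        + g w * (Complex.exp (-h w) * -(_root_.deriv g w / g w)) = 0 := by
      field_simp
      ring
    rw [h0] at this
    exact this
  have hcst := (convex_ball c r).is_const_of_fderivWithin_eq_zero (𝕜 := ℂ)
    (f := fun w ↦ g w * Complex.exp (-h w))
    (fun w hw ↦ (hderiv w hw).differentiableAt.differentiableWithinAt)
    (fun w hw ↦ by
      rw [fderivWithin_of_isOpen Metric.isOpen_ball hw]
      ext; simp [(hderiv w hw).deriv])
    hz (Metric.mem_ball_self hr)
  simp only [hc, neg_zero, Complex.exp_zero, mul_one] at hcst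
  rw [← hcst, mul_assoc, ← Complex.exp_add, neg_add_cancel, Complex.exp_zero, mul_one]

/-- An entire function that is not identically zero has finitely many zeros in a compact set. -/
lemma Differentiable.finite_zeros_inter {f : ℂ → ℂ} (hf : Differentiable ℂ f) {x : ℂ}
    (hx : f x ≠ 0) {K : Set ℂ} (hK : IsCompact K) : {z ∈ K | f z = 0}.Finite := by
  have h := AnalyticOnNhd.preimage_zero_mem_codiscrete (f := f) (fun z _ ↦ hf.analyticAt z) hx
  have h2 := hK.finite_sdiff_of_mem_codiscreteWithin
    (codiscreteWithin_mono (Set.subset_univ K) h)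
  refine h2.subset fun z hz ↦ ⟨hz.1, ?_⟩
  simpa using hz.2

namespace LogChange

/-- The vertices of a closed polygon through `2 ± iT` and `-1 ± iT`, listed counterclockwise. -/
noncomputable def hexagon (T : ℝ) : Fin 6 → ℂ :=
  ![1 / 2 - T * I, 2 - T * I, 2 + T * I, 1 / 2 + T * I, -1 + T * I, -1 - T * I]

lemma log_I_mul {z : ℂ} (hz : 0 < z.re) : Complex.log (I * z) = Complex.log z + π / 2 * I := by
  have h := abs_lt.1 (Complex.abs_arg_lt_pi_div_two_iff.2 (Or.inl hz))
  have hz0 : z ≠ 0 := by rintro rfl; simp at hz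
  rw [Complex.log_mul Complex.I_ne_zero hz0, Complex.log_I, add_comm]
  rw [Complex.arg_I]
  constructor <;> linarith [h.1, h.2]

/-- The change of the logarithm of `s - ρ` around the polygon. -/
lemma exists_hexagon_sub_const {T : ℝ} {ρ : ℂ} (h0 : 0 < ρ.re) (h1 : ρ.re < 1)
    (hT : |ρ.im| ≠ T) (hT0 : 0 < T) : ∃ δ : Fin 6 → ℂ,
      (∀ i, LogChange (fun s ↦ s - ρ) (hexagon T i) (hexagon T (i + 1)) (δ i)) ∧
      ∑ i, δ i = if |ρ.im| < T then 2 * π * I else 0 := by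
  have key (u : Fin 6 → ℂ) (hu : ∀ i, 0 < ((hexagon T i - ρ) * u i).re)
      (hu' : ∀ i, 0 < ((hexagon T (i + 1) - ρ) * u i).re) :
      ∀ i, LogChange (fun s ↦ s - ρ) (hexagon T i) (hexagon T (i + 1))
        (Complex.log ((hexagon T (i + 1) - ρ) * u i) - Complex.log ((hexagon T i - ρ) * u i)) :=
    fun i ↦ sub_const (hu i) (hu' i)
  rcases lt_or_gt_of_ne hT with hlt | hgt
  · have hlt' := abs_lt.1 hlt
    refine ⟨_, key ![I, 1, -I, -I, -1, I] ?_ ?_, ?_⟩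
    · simp [hexagon, Fin.forall_fin_succ]
      grind
    · simp [hexagon, Fin.forall_fin_succ, Fin.add_def]
      grind
    · rw [if_pos hlt]
      have hB := log_I_mul (z := 2 - T * I - ρ) (by simp; linarith)
      have hC := log_I_mul (z := (2 + T * I - ρ) * (-I)) (by simp; linarith)
      have hD := log_I_mul (z := (-1 + T * I - ρ) * (-1)) (by simp; linarith)
      have hA := log_I_mul (z := (-1 - T * I - ρ) * I) (by simp; linarith)
      rw [show I * (2 - T * I - ρ) = (2 - T * I - ρ) * I by ring] at hB
      rw [show I * ((2 + T * I - ρ) * (-I)) = (2 + T * I - ρ) by linear_combination (-(2 + T * I - ρ)) * Complex.I_sq] at hC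
      rw [show I * ((-1 + T * I - ρ) * (-1)) = (-1 + T * I - ρ) * (-I) by ring] at hD
      rw [show I * ((-1 - T * I - ρ) * I) = (-1 - T * I - ρ) * (-1) by linear_combination ((-1 - T * I - ρ)) * Complex.I_sq] at hA
      simp only [hexagon, Fin.sum_univ_six]
      simp [Fin.add_def] at *
      linear_combination hA + hB + hC + hD
  · rw [if_neg hgt.le.not_gt]
    rcases lt_abs.1 hgt with h | h
    · refine ⟨_, key (fun _ ↦ I) ?_ ?_, ?_⟩
      · simp [hexagon, Fin.forall_fin_succ]
        grind
      · simp [hexagon, Fin.forall_fin_succ, Fin.add_def]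
        grind
      · simp only [hexagon, Fin.sum_univ_six]
        simp [Fin.add_def]
    · refine ⟨_, key (fun _ ↦ -I) ?_ ?_, ?_⟩
      · simp [hexagon, Fin.forall_fin_succ]
        grind
      · simp [hexagon, Fin.forall_fin_succ, Fin.add_def]
        grind
      · simp only [hexagon, Fin.sum_univ_six]
        simp [Fin.add_def]

/-- The argument principle on the polygon, for an entire function. -/
lemma exists_hexagon {f : ℂ → ℂ} (hf : Differentiable ℂ f) {x : ℂ} (hx : f x ≠ 0) {T : ℝ}
    (hT : 0 < T) (hre : ∀ ρ, f ρ = 0 → 0 < ρ.re ∧ ρ.re < 1 ∧ |ρ.im| ≠ T) {S : Finset ℂ}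
    (hS : ∀ ρ, ρ ∈ S ↔ f ρ = 0 ∧ |ρ.im| < T) : ∃ δ : Fin 6 → ℂ,
      (∀ i, LogChange f (hexagon T i) (hexagon T (i + 1)) (δ i)) ∧
      ∑ i, δ i = 2 * π * I * ∑ ρ ∈ S, (analyticOrderNatAt f ρ : ℂ) := by
  have hfin := hf.finite_zeros_inter hx (isCompact_closedBall (0 : ℂ) (T + 3))
  obtain ⟨g, hg, hg0, hfg⟩ := hf.exists_eq_prod_sub_pow_mul hx hfin.toFinset
  have hgne : ∀ z ∈ Metric.ball (0 : ℂ) (T + 3), g z ≠ 0 := by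
    intro z hz h0
    by_cases hzf : z ∈ hfin.toFinset
    · exact hg0 z hzf h0
    · exact hzf (by simpa [hfg z, h0] using (Metric.ball_subset_closedBall hz))
  obtain ⟨h, hh, -, hgh⟩ := hg.exists_exp_eq_of_ball (by linarith) hgne
  have hmem : ∀ i, hexagon T i ∈ Metric.ball (0 : ℂ) (T + 3) := by
    have hb : ∀ a : ℝ, |a| ≤ 2 → ∀ b : ℝ, |b| ≤ T → (a + b * I : ℂ) ∈ Metric.ball (0 : ℂ) (T + 3) := by
      intro a ha b hb
      rw [mem_ball_zero_iff]
      refine (norm_add_le _ _).trans_lt ?_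
      simp only [Complex.norm_real, norm_mul, Complex.norm_I, Real.norm_eq_abs]
      linarith
    have e1 : |T| ≤ T := (abs_of_pos hT).le
    have e2 : |-T| ≤ T := by rw [abs_neg]; exact e1
    intro i
    fin_cases i
    · simpa [hexagon, sub_eq_add_neg] using hb (1 / 2) (by norm_num [abs_le]) (-T) e2
    · simpa [hexagon, sub_eq_add_neg] using hb 2 (by norm_num [abs_le]) (-T) e2
    · simpa [hexagon, sub_eq_add_neg] using hb 2 (by norm_num [abs_le]) T e1
    · simpa [hexagon, sub_eq_add_neg] using hb (1 / 2) (by norm_num [abs_le]) T e1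
    · simpa [hexagon, sub_eq_add_neg] using hb (-1) (by norm_num [abs_le]) T e1
    · simpa [hexagon, sub_eq_add_neg] using hb (-1) (by norm_num [abs_le]) (-T) e2
  have hseg : ∀ i, segment ℝ (hexagon T i) (hexagon T (i + 1)) ⊆ Metric.ball (0 : ℂ) (T + 3) :=
    fun i ↦ (convex_ball _ _).segment_subset (hmem i) (hmem (i + 1))
  have hg00 : g 0 ≠ 0 := hgne 0 (Metric.mem_ball_self (by linarith))
  have hgL : ∀ i, LogChange g (hexagon T i) (hexagon T (i + 1))
      (h (hexagon T (i + 1)) - h (hexagon T i)) := fun i ↦ by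
    have := of_exp (f := g) (h := fun z ↦ Complex.log (g 0) + h z)
      (continuousOn_const.add (hh.continuousOn.mono (hseg i))) fun s hs ↦ by
        rw [Complex.exp_add, Complex.exp_log hg00]
        exact hgh s (hseg i hs)
    simpa using this
  have hlin : ∀ ρ ∈ hfin.toFinset, ∃ δ : Fin 6 → ℂ,
      (∀ i, LogChange (fun s ↦ s - ρ) (hexagon T i) (hexagon T (i + 1)) (δ i)) ∧
      ∑ i, δ i = if |ρ.im| < T then 2 * π * I else 0 := fun ρ hρ ↦ by
    obtain ⟨h1, h2, h3⟩ := hre ρ (by simpa using (hfin.mem_toFinset.1 hρ).2)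
    exact exists_hexagon_sub_const h1 h2 h3 hT
  choose! δ hδ hδs using hlin
  refine ⟨fun i ↦ (∑ ρ ∈ hfin.toFinset, analyticOrderNatAt f ρ * δ ρ i)
    + (h (hexagon T (i + 1)) - h (hexagon T i)), fun i ↦ ?_, ?_⟩
  · exact ((prod _ fun ρ hρ ↦ (hδ ρ hρ i).pow _).mul (hgL i)).congr fun t _ ↦ hfg _
  · have hsub : S = hfin.toFinset.filter fun ρ ↦ |ρ.im| < T := by
      ext ρ
      simp only [hS, Finset.mem_filter, Set.Finite.mem_toFinset, Set.mem_ofPred_eq]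
      refine ⟨fun h ↦ ⟨⟨?_, h.1⟩, h.2⟩, fun h ↦ ⟨h.1.2, h.2⟩⟩
      obtain ⟨h1, h2, -⟩ := hre ρ h.1
      rw [mem_closedBall_zero_iff]
      refine (Complex.norm_le_abs_re_add_abs_im ρ).trans ?_
      rw [abs_of_pos h1]
      linarith [h.2]
    have htel : ∑ i : Fin 6, (h (hexagon T (i + 1)) - h (hexagon T i)) = 0 := by
      rw [Finset.sum_sub_distrib, sub_eq_zero]
      exact Equiv.sum_comp (Equiv.addRight (1 : Fin 6)) fun i ↦ h (hexagon T i)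
    rw [Finset.sum_add_distrib, htel, add_zero, Finset.sum_comm, hsub, Finset.sum_filter,
      Finset.mul_sum]
    refine Finset.sum_congr rfl fun ρ hρ ↦ ?_
    rw [← Finset.mul_sum, hδs ρ hρ]
    split_ifs <;> ring

/-- For a function symmetric under `s ↦ 1 - s`, half of the polygon suffices. -/
lemma exists_half_hexagon {f : ℂ → ℂ} (hf : Differentiable ℂ f) (hsymm : ∀ s, f (1 - s) = f s)
    {x : ℂ} (hx : f x ≠ 0) {T : ℝ}
    (hT : 0 < T) (hre : ∀ ρ, f ρ = 0 → 0 < ρ.re ∧ ρ.re < 1 ∧ |ρ.im| ≠ T) {S : Finset ℂ}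
    (hS : ∀ ρ, ρ ∈ S ↔ f ρ = 0 ∧ |ρ.im| < T) {a b c : ℂ}
    (ha : LogChange f (1 / 2 - T * I) (2 - T * I) a) (hb : LogChange f (2 - T * I) (2 + T * I) b)
    (hc : LogChange f (2 + T * I) (1 / 2 + T * I) c) :
      a + b + c = π * I * ∑ ρ ∈ S, (analyticOrderNatAt f ρ : ℂ) := by
  obtain ⟨δ, hδ, hsum⟩ := exists_hexagon hf hx hT hre hS
  have key : ∀ {z w d}, LogChange f z w d → LogChange f (1 - z) (1 - w) d := fun h ↦ by
    simpa only [hsymm] using h.comp_one_sub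
  have h0 : a = δ 0 := ha.unique (hδ 0)
  have h1 : b = δ 1 := hb.unique (hδ 1)
  have h2 : c = δ 2 := hc.unique (hδ 2)
  have h3 : a = δ 3 := (key ha).unique (by convert hδ 3 using 1 <;> simp [hexagon, Fin.add_def] <;> ring)
  have h4 : b = δ 4 := (key hb).unique (by convert hδ 4 using 1 <;> simp [hexagon, Fin.add_def] <;> ring)
  have h5 : c = δ 5 := (key hc).unique (by convert hδ 5 using 1 <;> simp [hexagon, Fin.add_def] <;> ring)
  rw [Fin.sum_univ_six, ← h0, ← h1, ← h2, ← h3, ← h4, ← h5] at hsum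
  linear_combination hsum / 2

end LogChange

/-- Jensen's bound for the number of zeros in a disc, as a sum of multiplicities. -/
lemma Differentiable.sum_analyticOrderNatAt_le {f : ℂ → ℂ} (hf : Differentiable ℂ f) {c : ℂ}
    (hc : f c = 1) {A r R : ℝ} (hr : 0 < r) (hrR : r < R) (hA : 0 ≤ A)
    (hM : ∀ z ∈ Metric.closedBall c R, ‖f z‖ ≤ Real.exp A) {S : Finset ℂ}
    (hS : ∀ ρ ∈ S, ρ ∈ Metric.closedBall c r) :
    (∑ ρ ∈ S, analyticOrderNatAt f ρ : ℕ) ≤ A / Real.log (R / r) := by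
  have hR : 0 < R := hr.trans hrR
  have han : ∀ U : Set ℂ, AnalyticOnNhd ℂ f U := fun U z _ ↦ hf.analyticAt z
  have hc0 : f c ≠ 0 := by rw [hc]; exact one_ne_zero
  have h := AnalyticOnNhd.sum_divisor_le (f := f) (c := c) (r := r) (R := R) (M := Real.exp A)
    (by rwa [abs_of_pos hr]) (by rwa [abs_of_pos hr, abs_of_pos hR]) (Real.one_le_exp hA)
    (han _) hc0 (fun z hz ↦ hM z (by
      rw [abs_of_pos hR] at hz; exact Metric.sphere_subset_closedBall hz))
  rw [abs_of_pos hr, hc, norm_one, div_one, Real.log_exp] at h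
  refine le_trans ?_ h
  have hdiv : ∀ ρ ∈ Metric.closedBall c r,
      MeromorphicOn.divisor f (Metric.closedBall c r) ρ = analyticOrderNatAt f ρ := fun ρ hρ ↦ by
    rw [MeromorphicOn.AnalyticOnNhd.divisor_apply (han _) hρ]
    rw [← Nat.cast_analyticOrderNatAt (hf.analyticOrderAt_ne_top hc0 ρ)]
    rfl
  have hfs := (MeromorphicOn.divisor f (Metric.closedBall c r)).finiteSupport
    (isCompact_closedBall c r)
  have hle : (∑ ρ ∈ S, analyticOrderNatAt f ρ : ℕ) ≤
      ∑ᶠ u, MeromorphicOn.divisor f (Metric.closedBall c r) u := by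
    rw [finsum_eq_sum_of_support_subset (s := S ∪ hfs.toFinset) _ (by
      intro x hx; simp only [Finset.coe_union, Set.Finite.coe_toFinset]; exact Or.inr hx)]
    push_cast
    rw [Finset.sum_congr rfl fun ρ hρ ↦ (hdiv ρ (hS ρ hρ)).symm]
    refine Finset.sum_le_sum_of_subset_of_nonneg Finset.subset_union_left fun i _ _ ↦ ?_
    by_cases hi : i ∈ Metric.closedBall c r
    · rw [hdiv i hi]; positivity
    · rw [Function.locallyFinsuppWithin.apply_eq_zero_of_notMem _ hi]
  exact_mod_cast hle

lemma Differentiable.exists_logChange_of_eq_one {f : ℂ → ℂ} (hf : Differentiable ℂ f) {c w : ℂ}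
    {A : ℝ} (hA : 0 < A) (hc : f c = 1)
    (hM : ∀ z ∈ Metric.closedBall c (19 / 10), ‖f z‖ ≤ Real.exp A)
    (hw : ‖w - c‖ ≤ 3 / 2) (him : w.im = c.im) 
    (h0 : ∀ z ∈ Metric.closedBall c (16 / 10), f z = 0 → z.im ≠ c.im) :
    ∃ δ, LogChange f c w δ ∧ |δ.im| ≤ 1000 * A := by
  have hc0 : f c ≠ 0 := by rw [hc]; exact one_ne_zero
  have hfin := hf.finite_zeros_inter hc0 (isCompact_closedBall c (16 / 10))
  obtain ⟨g, hg, hg0, hfg⟩ := hf.exists_eq_prod_sub_pow_mul hc0 hfin.toFinset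
  set S := hfin.toFinset with hSdef
  set m : ℂ → ℕ := fun ρ ↦ analyticOrderNatAt f ρ
  set n : ℕ := ∑ ρ ∈ S, m ρ with hn
  have hSm : ∀ ρ ∈ S, ρ ∈ Metric.closedBall c (16 / 10) ∧ f ρ = 0 := fun ρ hρ ↦ by
    simpa [hSdef] using hρ
  have hn7 : (n : ℝ) ≤ 7 * A := by
    refine (hf.sum_analyticOrderNatAt_le hc (by norm_num) (by norm_num) hA.le hM
      (fun ρ hρ ↦ (hSm ρ hρ).1)).trans ?_
    have : 1 - (19 / 10 / (16 / 10) : ℝ)⁻¹ ≤ Real.log (19 / 10 / (16 / 10)) :=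
      Real.one_sub_inv_le_log_of_pos (by norm_num)
    rw [div_le_iff₀ (by norm_num at *; linarith)]
    have h2 : (1 / 7 : ℝ) ≤ Real.log (19 / 10 / (16 / 10)) := by norm_num at *; linarith
    nlinarith
  have hgne : ∀ z ∈ Metric.closedBall c (16 / 10), g z ≠ 0 := by
    intro z hz h
    by_cases hzf : z ∈ S
    · exact hg0 z hzf h
    · exact hzf (by simpa [hSdef, hfg z, h] using hz)
  have hgc : g c ≠ 0 := hgne c (Metric.mem_closedBall_self (by norm_num))
  have hS1 : ∀ ρ ∈ S, ‖c - ρ‖ ≤ 16 / 10 := fun ρ hρ ↦ by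
    rw [norm_sub_rev]; simpa [dist_eq_norm] using (hSm ρ hρ).1
  have hPc : ‖g c‖⁻¹ ≤ (16 / 10) ^ n := by
    have h1 : ‖∏ ρ ∈ S, (c - ρ) ^ m ρ‖ ≤ (16 / 10) ^ n := by
      rw [norm_prod, hn, ← Finset.prod_pow_eq_pow_sum]
      refine Finset.prod_le_prod (fun _ _ ↦ norm_nonneg _) fun ρ hρ ↦ ?_
      rw [norm_pow]
      exact pow_le_pow_left₀ (norm_nonneg _) (hS1 ρ hρ) _
    refine le_trans (le_of_eq ?_) h1
    have := congrArg (‖·‖) (hfg c)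
    simp only [hc, norm_one, norm_mul] at this
    exact (eq_inv_of_mul_eq_one_left this.symm).symm
  have hgle : ∀ z ∈ Metric.closedBall c (19 / 10), ‖g z‖ ≤ Real.exp A * (10 / 3) ^ n := by
    intro z hz
    refine Complex.norm_le_of_forall_mem_frontier_norm_le (U := Metric.ball c (19 / 10))
      Metric.isBounded_ball hg.diffContOnCl (fun z hz ↦ ?_)
      (by rwa [closure_ball _ (by norm_num)])
    rw [frontier_ball _ (by norm_num), mem_sphere_iff_norm] at hz
    have h1 : (3 / 10) ^ n ≤ ‖∏ ρ ∈ S, (z - ρ) ^ m ρ‖ := by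
      rw [norm_prod, hn, ← Finset.prod_pow_eq_pow_sum]
      refine Finset.prod_le_prod (fun _ _ ↦ by positivity) fun ρ hρ ↦ ?_
      rw [norm_pow]
      refine pow_le_pow_left₀ (by norm_num) ?_ _
      have := norm_sub_norm_le (z - c) (ρ - c)
      rw [sub_sub_sub_cancel_right, hz, norm_sub_rev ρ c] at this
      linarith [hS1 ρ hρ]
    have h2 := hM z (by rw [mem_closedBall_iff_norm, hz])
    rw [hfg z, norm_mul] at h2
    have h3 : (3 / 10) ^ n * ‖g z‖ ≤ Real.exp A :=
      (mul_le_mul_of_nonneg_right h1 (norm_nonneg _)).trans h2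
    calc ‖g z‖ = (3 / 10) ^ n * ‖g z‖ * (10 / 3) ^ n := by
          rw [mul_right_comm, ← mul_pow]; norm_num
      _ ≤ _ := by gcongr
  obtain ⟨h, hh, hhc, hgh⟩ := hg.exists_exp_eq_of_ball (c := c) (r := 16 / 10) (by norm_num)
    fun z hz ↦ hgne z (Metric.ball_subset_closedBall hz)
  have hre : ∀ z ∈ Metric.ball c (16 / 10), (h z).re ≤ 32 * A := by
    intro z hz
    have h1 := hgle z (Metric.closedBall_subset_closedBall (by norm_num)
      (Metric.ball_subset_closedBall hz))
    rw [hgh z hz, norm_mul, Complex.norm_exp] at h1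
    have h2 : Real.exp (h z).re ≤ Real.exp A * (16 / 3) ^ n := by
      calc Real.exp (h z).re = ‖g c‖⁻¹ * (‖g c‖ * Real.exp (h z).re) := by
            rw [inv_mul_cancel_left₀ (norm_ne_zero_iff.2 hgc)]
        _ ≤ (16 / 10) ^ n * (Real.exp A * (10 / 3) ^ n) := by gcongr
        _ = Real.exp A * (16 / 3) ^ n := by
          rw [mul_left_comm, ← mul_pow]; norm_num
    have h3 : (16 / 3 : ℝ) ^ n ≤ Real.exp (13 / 3 * n) := by
      rw [mul_comm, Real.exp_nat_mul]
      exact pow_le_pow_left₀ (by norm_num) (by have := Real.add_one_le_exp (13 / 3 : ℝ); linarith) _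
    have h4 : Real.exp (h z).re ≤ Real.exp (A + 13 / 3 * n) := by
      rw [Real.exp_add]; exact h2.trans (by gcongr)
    linarith [Real.exp_le_exp.1 h4]
  have hwb : w ∈ Metric.ball c (16 / 10) := by
    rw [mem_ball_iff_norm]; linarith
  have hBC : ‖h w‖ ≤ 960 * A := by
    have hmaps : ∀ u ∈ Metric.ball (0 : ℂ) (16 / 10), c + u ∈ Metric.ball c (16 / 10) :=
      fun u hu ↦ by simpa [mem_ball_iff_norm] using hu
    have := Complex.borelCaratheodory_zero (f := fun u ↦ h (c + u)) (M := 32 * A) (R := 16 / 10)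
      (z := w - c) (by positivity)
      (hh.comp (by fun_prop) hmaps) (fun u hu ↦ hre _ (hmaps u hu)) (by norm_num)
      (by rw [mem_ball_zero_iff]; linarith) (by simpa using hhc)
    simp only [add_sub_cancel] at this
    refine this.trans ?_
    rw [div_le_iff₀ (by linarith)]
    nlinarith
  have hseg : segment ℝ c w ⊆ Metric.ball c (16 / 10) :=
    (convex_ball _ _).segment_subset (Metric.mem_ball_self (by norm_num)) hwb
  have hgL : LogChange g c w (h w - h c) := by
    have := LogChange.of_exp (f := g) (h := fun z ↦ Complex.log (g c) + h z)
      (continuousOn_const.add (hh.continuousOn.mono hseg)) fun s hs ↦ by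
        rw [Complex.exp_add, Complex.exp_log hgc]
        exact hgh s (hseg hs)
    simpa using this
  have hlin : ∀ ρ ∈ S, ∃ δ, LogChange (fun s ↦ s - ρ) c w δ ∧ |δ.im| ≤ π := fun ρ hρ ↦ by
    rcases lt_or_gt_of_ne (h0 ρ (hSm ρ hρ).1 (hSm ρ hρ).2) with hlt | hgt
    · exact LogChange.exists_sub_const (u := -I) (by simp; linarith) (by simp; linarith)
    · exact LogChange.exists_sub_const (u := I) (by simp; linarith) (by simp; linarith)
  choose! δ hδ hδπ using hlin
  refine ⟨(∑ ρ ∈ S, m ρ * δ ρ) + (h w - h c),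
    ((LogChange.prod _ fun ρ hρ ↦ (hδ ρ hρ).pow _).mul hgL).congr fun t _ ↦ hfg _, ?_⟩
  rw [hhc, sub_zero, Complex.add_im]
  refine (abs_add_le _ _).trans ?_
  have h1 : |(∑ ρ ∈ S, m ρ * δ ρ).im| ≤ n * π := by
    rw [Complex.im_sum]
    refine (Finset.abs_sum_le_sum_abs _ _).trans ?_
    rw [hn, Nat.cast_sum, Finset.sum_mul]
    refine Finset.sum_le_sum fun ρ hρ ↦ ?_
    rw [← Complex.ofReal_natCast, Complex.im_ofReal_mul, abs_mul, abs_of_nonneg (Nat.cast_nonneg _)]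
    exact mul_le_mul_of_nonneg_left (hδπ ρ hρ) (Nat.cast_nonneg _)
  have h2 := (Complex.abs_im_le_norm (h w)).trans hBC
  have h3 : n * π ≤ 28 * A := by
    have := Real.pi_le_four
    have := Real.pi_pos
    nlinarith
  linarith

/-- The argument of an entire function changes by a bounded multiple of the logarithm of its
growth along a horizontal segment free of zeros. -/
lemma Differentiable.exists_logChange {f : ℂ → ℂ} (hf : Differentiable ℂ f) {c w : ℂ}
    {A : ℝ} (hA : 0 < A) (hc : f c ≠ 0)
    (hM : ∀ z ∈ Metric.closedBall c (19 / 10), ‖f z‖ ≤ Real.exp A * ‖f c‖)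
    (hw : ‖w - c‖ ≤ 3 / 2) (him : w.im = c.im) 
    (h0 : ∀ z ∈ Metric.closedBall c (16 / 10), f z = 0 → z.im ≠ c.im) :
    ∃ δ, LogChange f c w δ ∧ |δ.im| ≤ 1000 * A := by
  have hn : 0 < ‖f c‖ := norm_pos_iff.2 hc
  obtain ⟨δ, hδ, hδA⟩ := Differentiable.exists_logChange_of_eq_one (f := fun z ↦ f z / f c)
    (hf.div_const _) (c := c) (w := w) hA (div_self hc)
    (fun z hz ↦ by rw [norm_div, div_le_iff₀ hn]; exact hM z hz) hw him
    (fun z hzb hz ↦ h0 z hzb (by simpa [hc] using hz))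
  refine ⟨δ, ?_, hδA⟩
  have hconst : LogChange (fun _ ↦ f c) c w 0 := by
    simpa using LogChange.of_exp (f := fun _ ↦ f c) (z := c) (w := w)
      (h := fun _ ↦ Complex.log (f c)) continuousOn_const fun s _ ↦ (Complex.exp_log hc).symm
  simpa using (hδ.mul hconst).congr (g := f) fun t _ ↦ (div_mul_cancel₀ _ hc).symm

/-- The terms of the Euler–Maclaurin type series `(s - 1) ζ(s) = 1 + ∑ zetaTerm n s`, which
converges for `0 < Re s`. -/
noncomputable def zetaTerm (n : ℕ) (s : ℂ) : ℂ :=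
  (s - 1) * (n + 1 : ℂ) ^ (-s) - ((n + 1 : ℂ) ^ (1 - s) - (n + 1 + 1 : ℂ) ^ (1 - s))

lemma differentiable_zetaTerm (n : ℕ) : Differentiable ℂ (zetaTerm n) := by
  have h1 : (n + 1 : ℂ) ≠ 0 := by exact_mod_cast n.succ_ne_zero
  have h2 : (n + 1 + 1 : ℂ) ≠ 0 := by exact_mod_cast (n + 1).succ_ne_zero
  intro s
  unfold zetaTerm
  refine DifferentiableAt.sub (.mul (by fun_prop) (.const_cpow (by fun_prop) (.inl h1))) (.sub ?_ ?_)
  · exact .const_cpow (by fun_prop) (.inl h1)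
  · exact .const_cpow (by fun_prop) (.inl h2)

lemma norm_zetaTerm_le (n : ℕ) {s : ℂ} {σ : ℝ} (hσ : 0 < σ) (hs : σ ≤ s.re) :
    ‖zetaTerm n s‖ ≤ ‖s - 1‖ * ‖s‖ * (n + 1 : ℝ) ^ (-σ - 1) := by
  have hn : (0 : ℝ) < n + 1 := by positivity
  set K := ‖s - 1‖ * ‖s‖ * (n + 1 : ℝ) ^ (-σ - 1) with hK
  have hder : ∀ (r : ℂ), ∀ x ∈ Set.Icc (n + 1 : ℝ) (n + 1 + 1),
      HasDerivWithinAt (fun y : ℝ ↦ (y : ℂ) ^ r) (r * (x : ℂ) ^ (r - 1))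
        (Set.Icc (n + 1 : ℝ) (n + 1 + 1)) x := fun r x hx ↦ by
    rcases eq_or_ne r 0 with rfl | hr
    · simpa using hasDerivWithinAt_const _ _ (1 : ℂ)
    exact (hasDerivAt_ofReal_cpow_const (hn.trans_le hx.1).ne' hr).hasDerivWithinAt
  have h1 : ∀ x ∈ Set.Icc (n + 1 : ℝ) (n + 1 + 1),
      ‖(x : ℂ) ^ (-s) - ((n + 1 : ℝ) : ℂ) ^ (-s)‖ ≤ ‖s‖ * (n + 1 : ℝ) ^ (-σ - 1) := by
    intro x hx
    have := norm_image_sub_le_of_norm_deriv_le_segment' (C := ‖s‖ * (n + 1 : ℝ) ^ (-σ - 1))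
      (hder (-s)) (fun y hy ↦ ?_) x hx
    · refine this.trans (mul_le_of_le_one_right (by positivity) (by linarith [hx.2]))
    · have hy0 : 0 < y := hn.trans_le hy.1
      rw [norm_mul, norm_neg, Complex.norm_cpow_eq_rpow_re_of_pos hy0]
      gcongr
      calc y ^ (-s - 1).re ≤ (n + 1 : ℝ) ^ (-s - 1).re :=
            Real.rpow_le_rpow_of_nonpos hn hy.1 (by simp; linarith)
        _ ≤ (n + 1 : ℝ) ^ (-σ - 1) :=
            Real.rpow_le_rpow_of_exponent_le (by linarith [n.cast_nonneg (α := ℝ)])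
              (by simp; linarith)
  have h2 := norm_image_sub_le_of_norm_deriv_le_segment' (C := K)
    (f := fun x : ℝ ↦ (x : ℂ) ^ (1 - s) - (1 - s) * ((n + 1 : ℝ) : ℂ) ^ (-s) * x)
    (f' := fun x : ℝ ↦ (1 - s) * (x : ℂ) ^ (1 - s - 1) - (1 - s) * ((n + 1 : ℝ) : ℂ) ^ (-s) * 1)
    (a := n + 1) (b := n + 1 + 1)
    (fun x hx ↦ (hder (1 - s) x hx).sub
      ((Complex.ofRealCLM.hasDerivAt.hasDerivWithinAt).const_mul _)) (fun x hx ↦ ?_) (n + 1 + 1)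
      (by simp)
  · refine (le_of_eq ?_).trans (h2.trans (by simp))
    congr 1
    unfold zetaTerm
    push_cast
    ring
  · rw [show (1 - s) * (x : ℂ) ^ (1 - s - 1) - (1 - s) * ((n + 1 : ℝ) : ℂ) ^ (-s) * 1
      = (1 - s) * ((x : ℂ) ^ (-s) - ((n + 1 : ℝ) : ℂ) ^ (-s)) by
        rw [show 1 - s - 1 = -s by ring]; ring, norm_mul, norm_sub_rev 1 s, hK, mul_assoc]
    exact mul_le_mul_of_nonneg_left (h1 x ⟨hx.1, hx.2.le⟩) (norm_nonneg _)

lemma summable_rpow_neg_sub_one {σ : ℝ} (hσ : 0 < σ) :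
    Summable fun n : ℕ ↦ (n + 1 : ℝ) ^ (-σ - 1) := by
  have h := (summable_nat_add_iff 1).2 (Real.summable_nat_rpow (p := -σ - 1).2 (by linarith))
  simpa using h

lemma riemannZeta₁_eq_of_one_lt_re {s : ℂ} (hs : 1 < s.re) :
    riemannZeta₁ s = 1 + ∑' n, zetaTerm n s := by
  have hs1 : s ≠ 1 := by rintro rfl; simp at hs
  have hsum : Summable fun n ↦ zetaTerm n s :=
    Summable.of_norm_bounded ((summable_rpow_neg_sub_one one_pos).mul_left _)
      fun n ↦ norm_zetaTerm_le n one_pos hs.le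
  have hz : Summable fun n : ℕ ↦ (n + 1 : ℂ) ^ (-s) := by
    have h := (summable_nat_add_iff 1).2 (Complex.summable_one_div_nat_cpow.2 hs)
    simpa [Complex.cpow_neg] using h
  have hz' : HasSum (fun n : ℕ ↦ (n + 1 : ℂ) ^ (-s)) (riemannZeta s) := by
    rw [zeta_eq_tsum_one_div_nat_add_one_cpow hs]
    simpa [Complex.cpow_neg] using hz.hasSum
  have htel : Tendsto (fun N : ℕ ↦ ∑ n ∈ Finset.range N,
      ((n + 1 : ℂ) ^ (1 - s) - (n + 1 + 1 : ℂ) ^ (1 - s))) atTop (𝓝 1) := by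
    have h1 : ∀ N : ℕ, ∑ n ∈ Finset.range N,
        ((n + 1 : ℂ) ^ (1 - s) - (n + 1 + 1 : ℂ) ^ (1 - s)) = 1 - (N + 1 : ℂ) ^ (1 - s) := by
      intro N
      have := Finset.sum_range_sub' (fun n : ℕ ↦ (n + 1 : ℂ) ^ (1 - s)) N
      simpa using this
    simp_rw [h1]
    have h2 : Tendsto (fun N : ℕ ↦ (N + 1 : ℂ) ^ (1 - s)) atTop (𝓝 0) := by
      rw [tendsto_zero_iff_norm_tendsto_zero]
      have h3 : ∀ N : ℕ, ‖(N + 1 : ℂ) ^ (1 - s)‖ = ((N + 1 : ℕ) : ℝ) ^ (-(s.re - 1)) := fun N ↦ by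
        rw [← Nat.cast_succ, Complex.norm_natCast_cpow_of_pos N.succ_pos]
        simp
      simp_rw [h3]
      exact ((tendsto_rpow_neg_atTop (by linarith)).comp tendsto_natCast_atTop_atTop).comp
        (tendsto_add_atTop_nat 1)
    simpa using tendsto_const_nhds.sub h2
  have hlim : Tendsto (fun N : ℕ ↦ ∑ n ∈ Finset.range N, zetaTerm n s) atTop
      (𝓝 ((s - 1) * riemannZeta s - 1)) := by
    have := (hz'.tendsto_sum_nat.const_mul (s - 1)).sub htel
    refine this.congr fun N ↦ ?_
    rw [Finset.mul_sum, ← Finset.sum_sub_distrib]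
    rfl
  rw [tendsto_nhds_unique hsum.hasSum.tendsto_sum_nat hlim, riemannZeta_eq_inv_sub_mul hs1,
    mul_inv_cancel_left₀ (sub_ne_zero.2 hs1)]
  ring

lemma riemannZeta₁_eq_of_re_pos {s : ℂ} (hs : 0 < s.re) :
    riemannZeta₁ s = 1 + ∑' n, zetaTerm n s := by
  have hopen : IsOpen {z : ℂ | 0 < z.re} := isOpen_lt continuous_const Complex.continuous_re
  have hconv : IsPreconnected {z : ℂ | 0 < z.re} := (convex_halfSpace_re_gt 0).isPreconnected
  have hd : DifferentiableOn ℂ (fun s ↦ 1 + ∑' n, zetaTerm n s) {z : ℂ | 0 < z.re} := by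
    refine (differentiableOn_const _).add fun z hz ↦ ?_
    have hz : 0 < z.re := hz
    set U := {w : ℂ | z.re / 2 < w.re} ∩ Metric.ball 0 (‖z‖ + 1) with hU
    have hUo : IsOpen U := (isOpen_lt continuous_const Complex.continuous_re).inter
      Metric.isOpen_ball
    have hzU : z ∈ U := ⟨by simp; linarith, by simp⟩
    have := Complex.differentiableOn_tsum_of_summable_norm (F := fun n w ↦ zetaTerm n w)
      (u := fun n : ℕ ↦ (‖z‖ + 2) * (‖z‖ + 1) * (n + 1 : ℝ) ^ (-(z.re / 2) - 1))
      ((summable_rpow_neg_sub_one (by linarith)).mul_left _)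
      (fun n ↦ (differentiable_zetaTerm n).differentiableOn) hUo fun n w hw ↦ by
        have hw2 : ‖w‖ ≤ ‖z‖ + 1 := (mem_ball_zero_iff.1 hw.2).le
        refine (norm_zetaTerm_le n (half_pos hz) hw.1.le).trans ?_
        gcongr
        refine (norm_sub_le _ _).trans ?_
        rw [norm_one]; linarith
    exact (this.differentiableAt (hUo.mem_nhds hzU)).differentiableWithinAt
  have h2 : (2 : ℂ) ∈ {z : ℂ | 0 < z.re} := by simp
  refine (differentiable_riemannZeta₁.differentiableOn.analyticOnNhd hopen).eqOn_of_preconnected_of_eventuallyEq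
    (hd.analyticOnNhd hopen) hconv h2 ?_ hs
  filter_upwards [(isOpen_lt continuous_const Complex.continuous_re).mem_nhds
    (show (2 : ℂ) ∈ {z : ℂ | 1 < z.re} by simp)] with z hz using riemannZeta₁_eq_of_one_lt_re hz

/-- Polynomial growth of `(s - 1) ζ(s)` in half-planes `σ ≤ Re s` with `0 < σ`. -/
lemma exists_norm_riemannZeta₁_le {σ : ℝ} (hσ : 0 < σ) :
    ∃ C > 0, ∀ s : ℂ, σ ≤ s.re → ‖riemannZeta₁ s‖ ≤ 1 + C * (‖s‖ + 1) ^ 2 := by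
  have hsum := summable_rpow_neg_sub_one hσ
  refine ⟨∑' n : ℕ, (n + 1 : ℝ) ^ (-σ - 1), hsum.tsum_pos (fun _ ↦ by positivity) 0 (by simp),
    fun s hs ↦ ?_⟩
  rw [riemannZeta₁_eq_of_re_pos (hσ.trans_le hs)]
  refine (norm_add_le _ _).trans ?_
  rw [norm_one]
  gcongr
  refine (tsum_of_norm_bounded (hsum.hasSum.mul_left _) fun n ↦
    norm_zetaTerm_le n hσ hs).trans ?_
  rw [mul_comm]
  gcongr
  have : ‖s - 1‖ ≤ ‖s‖ + 1 := by simpa using norm_sub_le s 1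
  rw [sq]
  gcongr
  linarith

lemma norm_riemannZeta_sub_one_le {s : ℂ} (hs : s.re = 2) : ‖riemannZeta s - 1‖ ≤ 13 / 20 := by
  have hs1 : 1 < s.re := by linarith
  have h := hasSum_zeta_two
  rw [← hasSum_nat_add_iff' 2] at h
  have hz := (Complex.summable_one_div_nat_cpow.2 hs1).hasSum
  rw [← zeta_eq_tsum_one_div_nat_cpow hs1, ← hasSum_nat_add_iff' 2] at hz
  have hs0 : s ≠ 0 := by rintro rfl; simp at hs
  simp only [Finset.sum_range_succ, Finset.sum_range_zero] at h hz
  norm_num [hs0] at h hz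
  have := tsum_of_norm_bounded h (f := fun n : ℕ ↦ ((n + 2 : ℂ) ^ s)⁻¹) fun n ↦ by
    rw [norm_inv, show (n + 2 : ℂ) = ((n + 2 : ℕ) : ℂ) by push_cast; ring,
      Complex.norm_natCast_cpow_of_pos (by omega), hs]
    norm_num
  rw [hz.tsum_eq] at this
  refine this.trans ?_
  have := Real.pi_lt_d4
  have := Real.pi_pos
  nlinarith

/-- The entire function `s (s - 1) Λ(s)`, i.e. twice the Riemann `ξ`-function. -/
noncomputable def riemannXi (s : ℂ) : ℂ := s * (s - 1) * completedRiemannZeta₀ s + 1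

lemma differentiable_riemannXi : Differentiable ℂ riemannXi :=
  ((differentiable_id.mul (differentiable_id.sub_const 1)).mul
    differentiable_completedZeta₀).add_const 1

lemma riemannXi_one_sub (s : ℂ) : riemannXi (1 - s) = riemannXi s := by
  unfold riemannXi
  rw [completedRiemannZeta₀_one_sub]
  ring

lemma riemannXi_one : riemannXi 1 = 1 := by simp [riemannXi]

lemma riemannXi_eq {s : ℂ} (hs : 0 < s.re) :
    riemannXi s = riemannZeta₁ s * (2 * (π : ℂ) ^ (-s / 2) * Complex.Gamma (s / 2 + 1)) := by
  rcases eq_or_ne s 1 with rfl | h1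
  · rw [riemannXi_one, riemannZeta₁_one, Complex.Gamma_add_one _ (by norm_num),
      Complex.Gamma_one_half_eq, neg_div, Complex.cpow_neg]
    have : (π : ℂ) ^ (1 / 2 : ℂ) ≠ 0 := by
      rw [Complex.cpow_ne_zero_iff]
      left; exact_mod_cast Real.pi_ne_zero
    field_simp
  · have hG : Complex.Gamma (s / 2 + 1) ≠ 0 := Complex.Gamma_ne_zero_of_re_pos (by simp; linarith)
    have hpi : (π : ℂ) ^ (-s / 2) ≠ 0 := by
      rw [Complex.cpow_ne_zero_iff]
      left; exact_mod_cast Real.pi_ne_zero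
    have h := riemannZeta_eq_mul_completedRiemannZeta₀ s
    rw [riemannZeta_eq_inv_sub_mul h1, eq_div_iff (mul_ne_zero (mul_ne_zero two_ne_zero hpi) hG), inv_mul_eq_div,
      div_mul_eq_mul_div, div_eq_iff (sub_ne_zero.2 h1)] at h
    have h1' : 1 - s ≠ 0 := sub_ne_zero.2 h1.symm
    rw [h, riemannXi]
    field_simp
    ring

lemma Gammafactor_ne_zero {s : ℂ} (hs : 0 < s.re) :
    2 * (π : ℂ) ^ (-s / 2) * Complex.Gamma (s / 2 + 1) ≠ 0 := by
  have hG : Complex.Gamma (s / 2 + 1) ≠ 0 := Complex.Gamma_ne_zero_of_re_pos (by simp; linarith)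
  have hpi : (π : ℂ) ^ (-s / 2) ≠ 0 := by
    rw [Complex.cpow_ne_zero_iff]
    left; exact_mod_cast Real.pi_ne_zero
  exact mul_ne_zero (mul_ne_zero two_ne_zero hpi) hG

lemma riemannXi_eq_zero_iff {s : ℂ} (hs : 0 < s.re) :
    riemannXi s = 0 ↔ riemannZeta₁ s = 0 := by
  rw [riemannXi_eq hs, mul_eq_zero, or_iff_left (Gammafactor_ne_zero hs)]

lemma riemannZeta₁_eq_zero_iff {s : ℂ} (hs : s ≠ 1) : riemannZeta₁ s = 0 ↔ riemannZeta s = 0 := by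
  rw [riemannZeta_eq_inv_sub_mul hs, mul_eq_zero, or_iff_right (inv_ne_zero (sub_ne_zero.2 hs))]

lemma re_lt_one_of_riemannXi_eq_zero {s : ℂ} (h : riemannXi s = 0) : s.re < 1 := by
  by_contra! hs
  have h1 : s ≠ 1 := by rintro rfl; simp [riemannXi_one] at h
  rw [riemannXi_eq_zero_iff (by linarith), riemannZeta₁_eq_zero_iff h1] at h
  exact riemannZeta_ne_zero_of_one_le_re hs h

lemma re_pos_of_riemannXi_eq_zero {s : ℂ} (h : riemannXi s = 0) : 0 < s.re := by
  have := re_lt_one_of_riemannXi_eq_zero (s := 1 - s) (by rw [riemannXi_one_sub, h])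
  simpa using this

/-- The zeros of `riemannXi` are the nontrivial zeros of `ζ`. -/
lemma riemannXi_eq_zero_iff_riemannZeta {s : ℂ} :
    riemannXi s = 0 ↔ riemannZeta s = 0 ∧ 0 < s.re ∧ s.re < 1 := by
  have key : 0 < s.re → s.re < 1 → (riemannXi s = 0 ↔ riemannZeta s = 0) := fun h0 h1 ↦ by
    rw [riemannXi_eq_zero_iff h0, riemannZeta₁_eq_zero_iff (by rintro rfl; simp at h1)]
  refine ⟨fun h ↦ ?_, fun h ↦ (key h.2.1 h.2.2).2 h.1⟩
  have h0 := re_pos_of_riemannXi_eq_zero h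
  have h1 := re_lt_one_of_riemannXi_eq_zero h
  exact ⟨(key h0 h1).1 h, h0, h1⟩

lemma analyticOrderNatAt_riemannXi {ρ : ℂ} (h0 : 0 < ρ.re) (h1 : ρ.re < 1) :
    analyticOrderNatAt riemannXi ρ = zetaZeroMultiplicity ρ := by
  have hρ1 : ρ ≠ 1 := by rintro rfl; simp at h1
  have hopen : IsOpen ({z : ℂ | 0 < z.re} ∩ {1}ᶜ) :=
    (isOpen_lt continuous_const Complex.continuous_re).inter isOpen_compl_singleton
  set E : ℂ → ℂ := fun s ↦ (s - 1) * (2 * (π : ℂ) ^ (-s / 2) * Complex.Gamma (s / 2 + 1))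
  have hE : AnalyticAt ℂ E ρ := by
    refine DifferentiableOn.analyticAt (s := {z : ℂ | 0 < z.re} ∩ {1}ᶜ) (fun z hz ↦ ?_)
      (hopen.mem_nhds ⟨h0, hρ1⟩)
    have hz : 0 < z.re := hz.1
    have hG : DifferentiableAt ℂ (fun s ↦ Complex.Gamma (s / 2 + 1)) z := by
      refine (Complex.differentiableAt_Gamma _ fun m hm ↦ ?_).comp z (by fun_prop)
      have := congrArg Complex.re hm
      simp at this
      linarith [m.cast_nonneg (α := ℝ)]
    have hP : DifferentiableAt ℂ (fun s ↦ (π : ℂ) ^ (-s / 2)) z :=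
      .const_cpow (by fun_prop) (.inl (by exact_mod_cast Real.pi_ne_zero))
    exact (DifferentiableAt.mul (by fun_prop)
      ((hP.const_mul 2).mul hG)).differentiableWithinAt
  have hE0 : E ρ ≠ 0 := mul_ne_zero (sub_ne_zero.2 hρ1) (Gammafactor_ne_zero h0)
  have hζ : AnalyticAt ℂ riemannZeta ρ := analyticOn_riemannZeta ρ hρ1
  have heq : riemannXi =ᶠ[𝓝 ρ] E * riemannZeta := by
    filter_upwards [hopen.mem_nhds ⟨h0, hρ1⟩] with z hz
    rw [riemannXi_eq hz.1, Pi.mul_apply, riemannZeta_eq_inv_sub_mul hz.2]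
    have : z - 1 ≠ 0 := sub_ne_zero.2 hz.2
    simp only [E]
    field_simp
  have hord : analyticOrderAt riemannXi ρ = analyticOrderAt riemannZeta ρ := by
    rw [analyticOrderAt_congr heq, analyticOrderAt_mul hE hζ, hE.analyticOrderAt_eq_zero.2 hE0,
      zero_add]
  have htop : analyticOrderAt riemannZeta ρ ≠ ⊤ := hord ▸
    differentiable_riemannXi.analyticOrderAt_ne_top (x := 1) (by simp [riemannXi_one]) ρ
  rw [analyticOrderNatAt, hord]
  obtain ⟨n, hn⟩ := ENat.ne_top_iff_exists.1 htop
  rw [← hn, ENat.toNat_natCast]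
  obtain ⟨h1, h2⟩ := (analyticOrderAt_eq_nat_iff_iteratedDeriv_eq_zero hζ).1 hn.symm
  refine le_antisymm ?_ (Nat.sInf_le h2)
  refine le_csInf ⟨n, h2⟩ fun k hk ↦ ?_
  by_contra! hkn
  exact hk (h1 k hkn)

lemma analyticOrderNatAt_riemannXi_one_sub (ρ : ℂ) :
    analyticOrderNatAt riemannXi (1 - ρ) = analyticOrderNatAt riemannXi ρ := by
  have h := analyticOrderAt_comp_of_deriv_ne_zero (f := riemannXi) (g := fun s : ℂ ↦ 1 - s)
    (z₀ := ρ) (by fun_prop) (by simp)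
  have hc : riemannXi ∘ (fun s : ℂ ↦ 1 - s) = riemannXi := funext riemannXi_one_sub
  rw [analyticOrderNatAt, analyticOrderNatAt, ← h, hc]

lemma re_riemannZeta_pos {s : ℂ} (hs : s.re = 2) : 0 < (riemannZeta s).re := by
  have h := (Complex.abs_re_le_norm _).trans (norm_riemannZeta_sub_one_le hs)
  rw [Complex.sub_re, Complex.one_re, abs_le] at h
  linarith [h.1]

/-- The argument of `(s - 1) ζ(s)` changes by `O(log T)` on horizontal segments starting at
`2 ± i T`. -/
lemma exists_logChange_riemannZeta₁_horizontal : ∃ C > 0, ∀ T ≥ (2 : ℝ), ∀ y : ℝ, |y| = T →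
    (∀ z, riemannXi z = 0 → z.im ≠ y) →
    ∃ δ, LogChange riemannZeta₁ (2 + y * I) (1 / 2 + y * I) δ ∧ |δ.im| ≤ C * Real.log T := by
  obtain ⟨C, hC, hbd⟩ := exists_norm_riemannZeta₁_le (σ := 1 / 10) (by norm_num)
  have hl2 : 0 < Real.log 2 := Real.log_pos (by norm_num)
  have hlC : 0 < Real.log (2 + 24 * C) := Real.log_pos (by linarith)
  refine ⟨1000 * (Real.log (2 + 24 * C) / Real.log 2 + 2), by positivity, fun T hT y hy hz ↦ ?_⟩
  have hlT : Real.log 2 ≤ Real.log T := Real.log_le_log (by norm_num) hT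
  set A := (Real.log (2 + 24 * C) / Real.log 2 + 2) * Real.log T with hAdef
  have hA : 0 < A := mul_pos (by positivity) (hl2.trans_le hlT)
  set c : ℂ := 2 + y * I with hcdef
  have hcre : c.re = 2 := by simp [hcdef]
  have hcim : c.im = y := by simp [hcdef]
  have hc1 : c ≠ 1 := fun h ↦ by rw [h] at hcre; norm_num at hcre
  have hexp : (2 + 24 * C) * T ^ 2 ≤ Real.exp A := by
    rw [← Real.log_le_iff_le_exp (by positivity), Real.log_mul (by positivity) (by positivity),
      Real.log_pow, hAdef, add_mul]
    have : Real.log (2 + 24 * C) ≤ Real.log (2 + 24 * C) / Real.log 2 * Real.log T := by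
      rw [div_mul_eq_mul_div, le_div_iff₀ hl2]
      exact mul_le_mul_of_nonneg_left hlT hlC.le
    push_cast
    linarith
  have hζ : 7 / 20 ≤ ‖riemannZeta c‖ := by
    have h1 := norm_riemannZeta_sub_one_le hcre
    have h2 := norm_sub_norm_le (1 : ℂ) (riemannZeta c)
    rw [norm_one, norm_sub_rev] at h2
    linarith
  have hf : 7 / 10 ≤ ‖riemannZeta₁ c‖ := by
    have h1 : riemannZeta₁ c = (c - 1) * riemannZeta c := by
      rw [riemannZeta_eq_inv_sub_mul hc1, mul_inv_cancel_left₀ (sub_ne_zero.2 hc1)]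
    have h2 : 2 ≤ ‖c - 1‖ := by
      refine le_trans ?_ (Complex.abs_im_le_norm _)
      rw [Complex.sub_im, hcim, Complex.one_im, sub_zero, hy]
      exact hT
    rw [h1, norm_mul]
    nlinarith [norm_nonneg (riemannZeta c)]
  have hcn : ‖c‖ ≤ T + 2 := by
    refine (Complex.norm_le_abs_re_add_abs_im c).trans ?_
    rw [hcre, hcim, hy, abs_two, add_comm]
  have hre : ∀ z ∈ Metric.closedBall c (19 / 10), 1 / 10 ≤ z.re := fun z hz ↦ by
    have := (Complex.abs_re_le_norm (z - c)).trans (mem_closedBall_iff_norm.1 hz)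
    rw [Complex.sub_re, hcre, abs_le] at this
    linarith [this.1]
  rw [mul_assoc]
  refine differentiable_riemannZeta₁.exists_logChange (c := c)
    (w := 1 / 2 + y * I) hA (norm_pos_iff.1 (by linarith)) (fun z hz ↦ ?_) ?_ (by simp [hcim])
    (fun z hzb hz0 ↦ ?_)
  · have h1 := hbd z (hre z hz)
    have h2 : ‖z‖ + 1 ≤ 4 * T := by
      have := norm_le_norm_add_norm_sub' z c
      have := mem_closedBall_iff_norm.1 hz
      linarith
    have h3 : (‖z‖ + 1) ^ 2 ≤ 16 * T ^ 2 := by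
      have := pow_le_pow_left₀ (by positivity) h2 2
      linarith
    have h4 : ‖riemannZeta₁ z‖ ≤ 7 / 10 * ((2 + 24 * C) * T ^ 2) := by
      have : C * (‖z‖ + 1) ^ 2 ≤ C * (16 * T ^ 2) := by gcongr
      nlinarith
    calc _ ≤ _ := h4
      _ ≤ ‖riemannZeta₁ c‖ * Real.exp A := by gcongr
      _ = _ := mul_comm _ _
  · rw [show (1 / 2 + y * I : ℂ) - c = ((-3 / 2 : ℝ) : ℂ) by rw [hcdef]; push_cast; ring,
      Complex.norm_real, Real.norm_eq_abs]
    norm_num [abs_le]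
  · rw [hcim]
    refine hz z ((riemannXi_eq_zero_iff ?_).2 hz0)
    linarith [hre z (Metric.closedBall_subset_closedBall (by norm_num) hzb)]

/-- The argument of `(s - 1) ζ(s)` is bounded on the line `Re s = 2`. -/
lemma exists_logChange_riemannZeta₁_vertical (T : ℝ) :
    ∃ δ, LogChange riemannZeta₁ (2 - T * I) (2 + T * I) δ ∧ |δ.im| ≤ 2 * π := by
  have hseg : ∀ s ∈ segment ℝ (2 - T * I) (2 + T * I), s.re = 2 := by
    rintro s ⟨a, b, -, -, hab, rfl⟩
    simp
    linarith
  have hne : ∀ s ∈ segment ℝ (2 - T * I) (2 + T * I), s ≠ 1 := fun s hs h ↦ by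
    have := hseg s hs
    rw [h] at this; norm_num at this
  obtain ⟨δ, hδ, hδ'⟩ := LogChange.exists_of_re_pos (f := fun s ↦ s - 1)
    (z := 2 - T * I) (w := 2 + T * I) (by fun_prop) fun s hs ↦ by
      rw [Complex.sub_re, hseg s hs]; norm_num
  obtain ⟨ε, hε, hε'⟩ := LogChange.exists_of_re_pos (f := riemannZeta)
    (z := 2 - T * I) (w := 2 + T * I)
    (fun s hs ↦ (differentiableAt_riemannZeta (hne s hs)).continuousAt.continuousWithinAt)
    fun s hs ↦ re_riemannZeta_pos (hseg s hs)
  refine ⟨δ + ε, (hδ.mul hε).congr fun t ht ↦ ?_, ?_⟩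
  · have : (2 - T * I : ℂ) + t * (2 + T * I - (2 - T * I)) ≠ 1 := by
      refine hne _ ?_
      rw [segment_eq_image']
      exact ⟨t, ht, by simp; ring⟩
    rw [riemannZeta_eq_inv_sub_mul this, mul_inv_cancel_left₀ (sub_ne_zero.2 this)]
  · rw [Complex.add_im]
    exact (abs_add_le _ _).trans (by linarith)

/-- Logarithms of Euler's sequence converging to the Gamma function. -/
noncomputable def cLogGammaSeq (z : ℂ) (n : ℕ) : ℂ :=
  z * Real.log n + Real.log n.factorial - ∑ k ∈ Finset.range (n + 1), Complex.log (z + k)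

lemma exp_cLogGammaSeq {z : ℂ} (hz : 0 < z.re) {n : ℕ} (hn : n ≠ 0) :
    Complex.exp (cLogGammaSeq z n) = Complex.GammaSeq z n := by
  have hne : ∀ k ∈ Finset.range (n + 1), Complex.exp (Complex.log (z + k)) = z + k :=
    fun k _ ↦ Complex.exp_log fun h ↦ by
      have := congrArg Complex.re h
      simp at this
      linarith [k.cast_nonneg (α := ℝ)]
  have h1 : ((Real.log n : ℝ) : ℂ) = Complex.log n := by simp
  have h2 : ((Real.log n.factorial : ℝ) : ℂ) = Complex.log n.factorial := by simp
  rw [cLogGammaSeq, Complex.exp_sub, Complex.exp_add, Complex.exp_sum, Finset.prod_congr rfl hne,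
    h1, h2, Complex.exp_log (by exact_mod_cast n.factorial_ne_zero), Complex.GammaSeq,
    Complex.cpow_def_of_ne_zero (by exact_mod_cast hn), mul_comm z]

lemma Complex.norm_log_one_add_sub_self_le_sq {w : ℂ} (hw : ‖w‖ ≤ 1 / 2) :
    ‖Complex.log (1 + w) - w‖ ≤ ‖w‖ ^ 2 := by
  refine (Complex.norm_log_one_add_sub_self_le (hw.trans_lt (by norm_num))).trans ?_
  have : (1 - ‖w‖)⁻¹ ≤ 2 := by
    rw [inv_le_comm₀ (by linarith) (by norm_num)]
    linarith
  nlinarith [sq_nonneg ‖w‖]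

lemma norm_cLogGammaSeq_succ_sub_le {R : ℝ} {z : ℂ} (hz : 0 < z.re) (hzR : ‖z‖ ≤ R) {n : ℕ}
    (hn : n ≠ 0) (hnR : 2 * R ≤ n + 1) :
    ‖cLogGammaSeq z (n + 1) - cLogGammaSeq z n‖ ≤ (R + R ^ 2) * (1 / ((n : ℝ) + 1) ^ 2) := by
  have hm : (0 : ℝ) < n + 1 := by positivity
  have hmc : (n : ℂ) + 1 ≠ 0 := by exact_mod_cast n.succ_ne_zero
  have hmn : ‖(n : ℂ) + 1‖ = n + 1 := by
    rw [← Nat.cast_succ, Complex.norm_natCast, Nat.cast_succ]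
  have hn1 : (1 : ℝ) ≤ n := by exact_mod_cast Nat.one_le_iff_ne_zero.2 hn
  have h1 : Complex.log (z + (n + 1 : ℕ)) = Real.log (n + 1) + Complex.log (1 + z / (n + 1)) := by
    have : z + (n + 1 : ℕ) = ((n + 1 : ℝ) : ℂ) * (1 + z / (n + 1)) := by
      push_cast; field_simp; ring
    rw [this, Complex.log_ofReal_mul hm]
    intro h
    rw [h, mul_zero] at this
    have := congrArg Complex.re this
    simp at this
    linarith
  have h2 : (Real.log n : ℂ) = Real.log (n + 1) + Complex.log (1 + -1 / (n + 1)) := by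
    have h0 : (n : ℝ) = (n + 1) * (1 + -1 / (n + 1)) := by field_simp; ring
    have h3 : (0 : ℝ) < 1 + -1 / (n + 1) := by
      by_contra! h
      nlinarith
    have h4 : (1 + -1 / (n + 1) : ℂ) = ((1 + -1 / (n + 1) : ℝ) : ℂ) := by push_cast; rfl
    rw [h4, ← Complex.ofReal_log h3.le, ← Complex.ofReal_add, ← Real.log_mul hm.ne' h3.ne', ← h0]
  have h3 : cLogGammaSeq z (n + 1) - cLogGammaSeq z n =
      -(z * (Complex.log (1 + -1 / (n + 1)) - -1 / (n + 1))) -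
        (Complex.log (1 + z / (n + 1)) - z / (n + 1)) := by
    have hf : (Real.log (n + 1).factorial : ℂ) = Real.log (n + 1) + Real.log n.factorial := by
      rw [Nat.factorial_succ, Nat.cast_mul, Real.log_mul (by positivity) (by positivity)]
      push_cast; rfl
    rw [cLogGammaSeq, cLogGammaSeq, Finset.sum_range_succ _ (n + 1), h1, h2, hf, Nat.cast_succ]
    ring
  have h4 : ‖-1 / ((n : ℂ) + 1)‖ = 1 / (n + 1) := by rw [norm_div, norm_neg, norm_one, hmn]
  have h5 : ‖z / ((n : ℂ) + 1)‖ ≤ R / (n + 1) := by rw [norm_div, hmn]; gcongr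
  have h6 : 1 / ((n : ℝ) + 1) ≤ 1 / 2 := by gcongr; linarith
  have h7 : R / ((n : ℝ) + 1) ≤ 1 / 2 := by rw [div_le_iff₀ hm]; linarith
  have hR : 0 ≤ R := (norm_nonneg z).trans hzR
  rw [h3]
  calc _ ≤ ‖z‖ * ‖Complex.log (1 + -1 / (n + 1)) - -1 / (n + 1)‖ +
        ‖Complex.log (1 + z / (n + 1)) - z / (n + 1)‖ := by
        refine (norm_sub_le _ _).trans ?_
        rw [norm_neg, norm_mul]
    _ ≤ R * (1 / (n + 1)) ^ 2 + (R / (n + 1)) ^ 2 := by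
        have := Complex.norm_log_one_add_sub_self_le_sq (h4.trans_le h6)
        rw [h4] at this
        have h8 := Complex.norm_log_one_add_sub_self_le_sq (h5.trans h7)
        have h9 := h8.trans (pow_le_pow_left₀ (norm_nonneg _) h5 2)
        gcongr
    _ = _ := by field_simp

/-- A continuous logarithm of the Gamma function on bounded subsets of the right half plane. -/
lemma exists_log_Gamma (R : ℝ) : ∃ L : ℂ → ℂ, ContinuousOn L {z | 0 < z.re ∧ ‖z‖ ≤ R} ∧
    ∀ z, 0 < z.re → ‖z‖ ≤ R → Tendsto (cLogGammaSeq z) atTop (𝓝 (L z)) ∧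
      Complex.exp (L z) = Complex.Gamma z := by
  set S : Set ℂ := {z | 0 < z.re ∧ ‖z‖ ≤ R}
  have hcont : ∀ n, ContinuousOn (fun z ↦ cLogGammaSeq z n) S := fun n ↦ by
    unfold cLogGammaSeq
    refine ContinuousOn.sub (by fun_prop) (continuousOn_finsetSum _ fun k _ ↦ ?_)
    refine ContinuousOn.clog (by fun_prop) fun z hz ↦ Or.inl ?_
    have := hz.1
    simp
    positivity
  have hsum : Summable fun n : ℕ ↦ (R + R ^ 2) * (1 / ((n : ℝ) + 1) ^ 2) := by
    refine Summable.mul_left _ ?_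
    have := (summable_nat_add_iff 1).2 (Real.summable_one_div_nat_pow.2 (one_lt_two))
    simpa using this
  have hunif := tendstoUniformlyOn_tsum_nat_eventually
    (f := fun n z ↦ cLogGammaSeq z (n + 1) - cLogGammaSeq z n) (s := S) hsum (by
      filter_upwards [eventually_ne_atTop 0, eventually_ge_atTop ⌈2 * R⌉₊] with n hn hnR z hz
      exact norm_cLogGammaSeq_succ_sub_le hz.1 hz.2 hn (by linarith [Nat.ceil_le.1 hnR]))
  have hlim : ∀ z ∈ S, Tendsto (cLogGammaSeq z) atTop
      (𝓝 (∑' n, (cLogGammaSeq z (n + 1) - cLogGammaSeq z n) + cLogGammaSeq z 0)) := fun z hz ↦ by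
    have := (hunif.tendsto_at hz).add_const (cLogGammaSeq z 0)
    refine this.congr fun n ↦ ?_
    rw [Finset.sum_range_sub]
    ring
  refine ⟨fun z ↦ ∑' n, (cLogGammaSeq z (n + 1) - cLogGammaSeq z n) + cLogGammaSeq z 0,
    (hunif.continuousOn ?_).add (hcont 0), fun z hz hzR ↦ ⟨hlim z ⟨hz, hzR⟩, ?_⟩⟩
  · exact Frequently.of_forall fun N ↦ continuousOn_finsetSum _
      fun n _ ↦ (hcont (n + 1)).sub (hcont n)
  · refine tendsto_nhds_unique ((Complex.continuous_exp.tendsto _).comp (hlim z ⟨hz, hzR⟩)) ?_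
    refine (Complex.GammaSeq_tendsto_Gamma z).congr' ?_
    filter_upwards [eventually_ne_atTop 0] with n hn
    exact (exp_cLogGammaSeq hz hn).symm

/-- The primitive of `u ↦ arg (u + i y)` given by `Im (w log w - w)`, where `w = u + i y`. -/
noncomputable def argPrimitive (y u : ℝ) : ℝ :=
  ((u + y * I) * Complex.log (u + y * I) - (u + y * I)).im

lemma hasDerivAt_argPrimitive (y : ℝ) {u : ℝ} (hu : 0 < u) :
    HasDerivAt (argPrimitive y) (Complex.arg (u + y * I)) u := by
  have hs : (u + y * I : ℂ) ∈ Complex.slitPlane := Or.inl (by simpa using hu)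
  have h1 : HasDerivAt (fun z : ℂ ↦ z + y * I) 1 u := (hasDerivAt_id _).add_const _
  have h2 := ((h1.mul (h1.clog hs)).sub h1).comp_ofReal
  have h3 := Complex.imCLM.hasFDerivAt.comp_hasDerivAt u h2
  convert! h3 using 1
  have : (u + y * I : ℂ) ≠ 0 := Complex.slitPlane_ne_zero hs
  simp [this, Complex.log_im]

lemma antitoneOn_arg_add {y : ℝ} (hy : 0 < y) :
    AntitoneOn (fun u : ℝ ↦ Complex.arg (u + y * I)) (Set.Ioi 0) := by
  intro u hu v hv huv
  rw [Set.mem_Ioi] at hu hv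
  simp only
  rw [Complex.arg_of_re_nonneg (by simpa using hv.le),
    Complex.arg_of_re_nonneg (by simpa using hu.le)]
  apply Real.monotone_arcsin
  have h : ∀ a : ℝ, (a + y * I).im = y := fun a ↦ by simp
  rw [h, h, Complex.norm_add_mul_I, Complex.norm_add_mul_I]
  gcongr

lemma integral_arg_add {y : ℝ} (hy : 0 < y) {a b : ℝ} (ha : 0 < a) (hab : a ≤ b) :
    ∫ u in a..b, Complex.arg (u + y * I) = argPrimitive y b - argPrimitive y a := by
  have hsub : Set.uIcc a b ⊆ Set.Ioi 0 := by
    rw [Set.uIcc_of_le hab]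
    exact fun u hu ↦ ha.trans_le hu.1
  refine intervalIntegral.integral_eq_sub_of_hasDerivAt
    (fun u hu ↦ hasDerivAt_argPrimitive y (hsub hu)) ?_
  exact ((antitoneOn_arg_add hy).mono hsub).intervalIntegrable

lemma le_sum_arg_add {x y : ℝ} (hx : 0 < x) (hy : 0 < y) (n : ℕ) :
    argPrimitive y (x + (n + 1)) - argPrimitive y x ≤
      ∑ k ∈ Finset.range (n + 1), Complex.arg (x + y * I + k) := by
  have h := AntitoneOn.integral_le_sum (x₀ := x) (a := n + 1)
    ((antitoneOn_arg_add hy).mono fun u hu ↦ hx.trans_le hu.1)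
  rw [integral_arg_add hy hx (by simp; positivity)] at h
  push_cast at h
  refine h.trans_eq (Finset.sum_congr rfl fun k _ ↦ ?_)
  congr 1
  ring

lemma sum_arg_add_le {x y : ℝ} (hx : 0 < x) (hy : 0 < y) (n : ℕ) :
    ∑ k ∈ Finset.range (n + 1), Complex.arg (x + y * I + k) ≤
      argPrimitive y (x + n) - argPrimitive y x + π / 2 := by
  have h := AntitoneOn.sum_le_integral (x₀ := x) (a := n)
    ((antitoneOn_arg_add hy).mono fun u hu ↦ hx.trans_le hu.1)
  rw [integral_arg_add hy hx (by simp)] at h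
  rw [Finset.sum_range_succ']
  have h1 : Complex.arg (x + y * I + (0 : ℕ)) ≤ π / 2 :=
    (abs_le.1 (Complex.abs_arg_le_pi_div_two_iff.2 (by simpa using hx.le))).2
  refine add_le_add (le_trans (le_of_eq (Finset.sum_congr rfl fun k _ ↦ ?_)) h) h1
  congr 1
  push_cast
  ring

lemma tendsto_argPrimitive_sub (y : ℝ) :
    Tendsto (fun u ↦ argPrimitive y u - y * Real.log u) atTop (𝓝 0) := by
  have h1 : Tendsto (fun u : ℝ ↦ (u : ℂ) * Complex.log (1 + y * I / u)) atTop (𝓝 (y * I)) := by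
    refine Complex.tendsto_mul_log_one_add_of_tendsto (tendsto_const_nhds.congr' ?_)
    filter_upwards [eventually_ne_atTop 0] with u hu
    have : (u : ℂ) ≠ 0 := by exact_mod_cast hu
    field_simp
  have h2 : Tendsto (fun u : ℝ ↦ (u : ℂ)⁻¹) atTop (𝓝 0) := by
    have := (tendsto_inv_atTop_zero (𝕜 := ℝ)).ofReal
    simpa using this
  have h3 : Tendsto (fun u : ℝ ↦
      ((1 + y * I * (u : ℂ)⁻¹) * ((u : ℂ) * Complex.log (1 + y * I / u)) - (u + y * I)).im)
      atTop (𝓝 0) := by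
    have h4 := ((h2.const_mul (y * I)).const_add 1).mul h1
    have h5 := (Complex.continuous_im.tendsto _).comp (h4.sub_const (y * I))
    simp only [mul_zero, add_zero, one_mul, sub_self, Complex.zero_im] at h5
    refine h5.congr fun u ↦ ?_
    simp
  refine h3.congr' ?_
  filter_upwards [eventually_gt_atTop 0] with u hu
  have hu' : (u : ℂ) ≠ 0 := by exact_mod_cast hu.ne'
  have h6 : (u + y * I : ℂ) = u * (1 + y * I / u) := by field_simp
  have h7 : (1 + y * I / u : ℂ) ≠ 0 := fun h ↦ by
    rw [h, mul_zero] at h6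
    have := congrArg Complex.re h6
    simp at this
    linarith
  have h8 : Complex.log (u + y * I) = Real.log u + Complex.log (1 + y * I / u) := by
    rw [h6, Complex.log_ofReal_mul hu h7]
  have h9 : (y * Real.log u : ℝ) = ((u + y * I) * Real.log u : ℂ).im := by simp
  rw [argPrimitive, h8, h9, ← Complex.sub_im]
  congr 1
  field_simp
  ring

lemma im_cLogGammaSeq (x y : ℝ) (n : ℕ) : (cLogGammaSeq (x + y * I) n).im =
    y * Real.log n - ∑ k ∈ Finset.range (n + 1), Complex.arg (x + y * I + k) := by
  rw [cLogGammaSeq, Complex.sub_im, Complex.add_im, Complex.ofReal_im, add_zero, Complex.im_mul_ofReal,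
    Complex.im_sum]
  simp [Complex.log_im]

lemma tendsto_log_sub_log_add (x : ℝ) :
    Tendsto (fun n : ℕ ↦ Real.log n - Real.log (x + n)) atTop (𝓝 0) := by
  have h1 := (Real.continuousAt_log one_ne_zero).tendsto.comp (tendsto_natCast_div_add_atTop x)
  rw [Real.log_one] at h1
  refine h1.congr' ?_
  filter_upwards [eventually_gt_atTop 0, eventually_gt_atTop ⌈-x⌉₊] with n hn hnx
  have := (Nat.le_ceil (-x)).trans_lt (Nat.cast_lt.2 hnx)
  rw [Function.comp_apply, Real.log_div (by positivity) (by linarith), add_comm x]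

/-- The imaginary part of a limit of the logarithms of Euler's sequence. -/
lemma abs_im_sub_argPrimitive_le {x y : ℝ} (hx : 0 < x) (hy : 0 < y) {l : ℂ}
    (hl : Tendsto (cLogGammaSeq (x + y * I)) atTop (𝓝 l)) :
    |l.im - argPrimitive y x| ≤ π / 2 := by
  have hlim := (Complex.continuous_im.tendsto _).comp hl
  have key : ∀ a : ℝ, Tendsto (fun n : ℕ ↦ y * Real.log n - argPrimitive y (a + n)) atTop (𝓝 0) := by
    intro a
    have h1 := (tendsto_argPrimitive_sub y).comp
      (tendsto_atTop_add_const_left _ a (tendsto_natCast_atTop_atTop (R := ℝ)))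
    have h2 := ((tendsto_log_sub_log_add a).const_mul y).sub h1
    rw [mul_zero, sub_zero] at h2
    refine h2.congr fun n ↦ ?_
    simp only [Function.comp_apply]
    ring
  rw [abs_le]
  constructor
  · have h := le_of_tendsto_of_tendsto ((key x).add_const (argPrimitive y x - π / 2)) hlim
      (Eventually.of_forall fun n ↦ by
        have := sum_arg_add_le hx hy n
        rw [Function.comp_apply, im_cLogGammaSeq]
        linarith)
    linarith
  · have h := le_of_tendsto_of_tendsto hlim ((key (x + 1)).add_const (argPrimitive y x))
      (Eventually.of_forall fun n ↦ by
        have := le_sum_arg_add hx hy n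
        rw [show x + ((n : ℝ) + 1) = x + 1 + n by ring] at this
        rw [Function.comp_apply, im_cLogGammaSeq]
        linarith)
    have := Real.pi_pos
    linarith

lemma cLogGammaSeq_conj {z : ℂ} (hz : 0 < z.re) (n : ℕ) :
    cLogGammaSeq (starRingEnd ℂ z) n = starRingEnd ℂ (cLogGammaSeq z n) := by
  rw [cLogGammaSeq, cLogGammaSeq, map_sub, map_add, map_mul, Complex.conj_ofReal,
    Complex.conj_ofReal, map_sum]
  congr 1
  refine Finset.sum_congr rfl fun k _ ↦ ?_
  rw [← Complex.log_conj, map_add, Complex.conj_natCast]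
  rw [Ne, Complex.arg_eq_pi_iff]
  simp
  intro h
  linarith [k.cast_nonneg (α := ℝ)]

lemma abs_argPrimitive_sub_le {x y : ℝ} (hx : 0 < x) (hy : 0 < y) :
    |argPrimitive y x - (y * Real.log y - y)| ≤ x + x * (π / 2) := by
  set w : ℂ := x + y * I with hw
  have hre : w.re = x := by simp [hw]
  have him : w.im = y := by simp [hw]
  have h1 : argPrimitive y x = y * Real.log ‖w‖ + x * Complex.arg w - y := by
    rw [argPrimitive, ← hw, Complex.sub_im, Complex.mul_im, Complex.log_im, Complex.log_re, hre, him]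
    ring
  have hyw : y ≤ ‖w‖ := by
    have := Complex.abs_im_le_norm w
    rwa [him, abs_of_pos hy] at this
  have hwxy : ‖w‖ ≤ x + y := by
    have := Complex.norm_le_abs_re_add_abs_im w
    rwa [hre, him, abs_of_pos hx, abs_of_pos hy] at this
  have h2 : 0 ≤ Real.log ‖w‖ - Real.log y := sub_nonneg.2 (Real.log_le_log hy hyw)
  have h3 : y * (Real.log ‖w‖ - Real.log y) ≤ x := by
    rw [← Real.log_div (hy.trans_le hyw).ne' hy.ne']
    have h4 := Real.log_le_sub_one_of_pos (div_pos (hy.trans_le hyw) hy)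
    calc _ ≤ y * (‖w‖ / y - 1) := by gcongr
      _ = ‖w‖ - y := by field_simp
      _ ≤ x := by linarith
  have h5 : |x * Complex.arg w| ≤ x * (π / 2) := by
    rw [abs_mul, abs_of_pos hx]
    gcongr
    exact Complex.abs_arg_le_pi_div_two_iff.2 (by rw [hre]; exact hx.le)
  rw [h1, show y * Real.log ‖w‖ + x * Complex.arg w - y - (y * Real.log y - y) =
    y * (Real.log ‖w‖ - Real.log y) + x * Complex.arg w by ring]
  refine (abs_add_le _ _).trans (add_le_add ?_ h5)
  rwa [abs_of_nonneg (mul_nonneg hy.le h2)]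

/-- **Stirling's formula** for the change of the argument of `Γ` on a vertical segment. -/
lemma abs_im_sub_im_sub_le {x y : ℝ} (hx : 0 < x) (hy : 0 < y) {l m : ℂ}
    (hl : Tendsto (cLogGammaSeq (x + y * I)) atTop (𝓝 l))
    (hm : Tendsto (cLogGammaSeq (x - y * I)) atTop (𝓝 m)) :
    |(l - m).im - 2 * (y * Real.log y - y)| ≤ π + 2 * (x + x * (π / 2)) := by
  have hconj : m = starRingEnd ℂ l := by
    refine tendsto_nhds_unique hm (((Complex.continuous_conj.tendsto _).comp hl).congr fun n ↦ ?_)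
    rw [Function.comp_apply, ← cLogGammaSeq_conj (by simpa using hx)]
    congr 1
    simp [sub_eq_add_neg]
  have h1 := abs_im_sub_argPrimitive_le hx hy hl
  have h2 := abs_argPrimitive_sub_le hx hy
  rw [hconj, Complex.sub_im, Complex.conj_im]
  rw [abs_le] at *
  constructor <;> linarith [h1.1, h1.2, h2.1, h2.2]

lemma LogChange.riemannXi {L : ℂ → ℂ} {R : ℝ}
    (hL : ContinuousOn L {z | 0 < z.re ∧ ‖z‖ ≤ R})
    (hexp : ∀ z, 0 < z.re → ‖z‖ ≤ R → Complex.exp (L z) = Complex.Gamma z)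
    {z w δ : ℂ} (hz : 0 < z.re) (hw : 0 < w.re) (hzR : ‖z / 2 + 1‖ ≤ R) (hwR : ‖w / 2 + 1‖ ≤ R)
    (h : LogChange riemannZeta₁ z w δ) :
    LogChange _root_.riemannXi z w (δ + ((L (w / 2 + 1) - w / 2 * Real.log π) -
      (L (z / 2 + 1) - z / 2 * Real.log π))) := by
  have hseg : ∀ s ∈ segment ℝ z w, 0 < s.re ∧ ‖s / 2 + 1‖ ≤ R := by
    rintro s ⟨a, b, ha, hb, hab, rfl⟩
    have h1 : ((a • z + b • w) / 2 + 1 : ℂ) = a • (z / 2 + 1) + b • (w / 2 + 1) := by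
      have : (a : ℂ) + b = 1 := by exact_mod_cast hab
      simp only [Complex.real_smul]
      linear_combination -this
    constructor
    · exact (convex_halfSpace_re_gt 0) hz hw ha hb hab
    · rw [h1, ← mem_closedBall_zero_iff]
      exact convex_closedBall _ _ (mem_closedBall_zero_iff.2 hzR) (mem_closedBall_zero_iff.2 hwR)
        ha hb hab
  have hseg' : ∀ s ∈ segment ℝ z w, s / 2 + 1 ∈ {z : ℂ | 0 < z.re ∧ ‖z‖ ≤ R} := fun s hs ↦ by
    refine ⟨?_, (hseg s hs).2⟩
    have := (hseg s hs).1
    simp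
    linarith
  have h2 : LogChange (fun s ↦ 2 * (π : ℂ) ^ (-s / 2) * Complex.Gamma (s / 2 + 1)) z w
      ((Real.log 2 + (L (w / 2 + 1) - w / 2 * Real.log π)) -
        (Real.log 2 + (L (z / 2 + 1) - z / 2 * Real.log π))) := by
    refine LogChange.of_exp (h := fun s ↦ Real.log 2 + (L (s / 2 + 1) - s / 2 * Real.log π)) ?_
      fun s hs ↦ ?_
    · exact continuousOn_const.add ((hL.comp (by fun_prop) hseg').sub (by fun_prop))
    · rw [Complex.exp_add, Complex.exp_sub, hexp _ (hseg' s hs).1 (hseg' s hs).2,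
        ← Complex.ofReal_exp, Real.exp_log two_pos,
        Complex.cpow_def_of_ne_zero (by exact_mod_cast pi_ne_zero), ← Complex.ofReal_log pi_pos.le,
        show (Real.log π * (-s / 2) : ℂ) = -(s / 2 * Real.log π) by ring, Complex.exp_neg]
      push_cast
      ring
  have h3 := (h.mul h2).congr (g := _root_.riemannXi) fun t ht ↦ riemannXi_eq (hseg _ (by
    rw [segment_eq_image']
    exact ⟨t, ht, by simp⟩)).1
  convert! h3 using 1
  ring

/-- The count of the zeros of `ξ` with `|Im ρ| < T`, for `T` not the ordinate of a zero. -/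
lemma exists_abs_sum_analyticOrderNatAt_riemannXi_sub_le : ∃ C > 0, ∀ T ≥ (2 : ℝ),
    (∀ z, riemannXi z = 0 → |z.im| ≠ T) → ∀ S : Finset ℂ,
    (∀ ρ, ρ ∈ S ↔ riemannXi ρ = 0 ∧ |ρ.im| < T) →
    |π * ∑ ρ ∈ S, (analyticOrderNatAt riemannXi ρ : ℝ) - (T * Real.log (T / (2 * π)) - T)| ≤
      C * Real.log T := by
  obtain ⟨C, hC, hhor⟩ := exists_logChange_riemannZeta₁_horizontal
  have hl2 : 0 < Real.log 2 := Real.log_pos (by norm_num)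
  have hpi := Real.pi_pos
  set K : ℝ := 2 * π + (π + 2 * (5 / 4 + 5 / 4 * (π / 2)))
  have hK : 0 < K := by positivity
  refine ⟨2 * C + K / Real.log 2, by positivity, fun T hT hTz S hS ↦ ?_⟩
  have hT0 : 0 < T := by linarith
  have hlT : Real.log 2 ≤ Real.log T := Real.log_le_log (by norm_num) hT
  obtain ⟨δ₁, hδ₁, hδ₁C⟩ := hhor T hT T (abs_of_pos hT0) fun z hz h ↦
    hTz z hz (by rw [h, abs_of_pos hT0])
  obtain ⟨δ₂, hδ₂, hδ₂C⟩ := hhor T hT (-T) (by rw [abs_neg, abs_of_pos hT0]) fun z hz h ↦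
    hTz z hz (by rw [h, abs_neg, abs_of_pos hT0])
  rw [Complex.ofReal_neg, neg_mul, ← sub_eq_add_neg, ← sub_eq_add_neg] at hδ₂
  obtain ⟨δ₃, hδ₃, hδ₃C⟩ := exists_logChange_riemannZeta₁_vertical T
  obtain ⟨L, hL, hLlim⟩ := exists_log_Gamma (T + 2)
  have hexp := fun z hz hzR ↦ (hLlim z hz hzR).2
  have hnorm : ∀ s : ℂ, 0 ≤ s.re → s.re ≤ 2 → |s.im| = T → ‖s / 2 + 1‖ ≤ T + 2 :=
    fun s hs hs2 hsT ↦ by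
      refine (Complex.norm_le_abs_re_add_abs_im _).trans ?_
      have h1 : (s / 2 + 1).re = s.re / 2 + 1 := by simp
      have h2 : (s / 2 + 1).im = s.im / 2 := by simp
      rw [h1, h2, abs_of_nonneg (by linarith), abs_div, hsT, abs_two]
      linarith
  have hre : ∀ (x y : ℝ), (x + y * I : ℂ).re = x ∧ (x + y * I : ℂ).im = y := by simp
  have n1 : ‖(1 / 2 - T * I : ℂ) / 2 + 1‖ ≤ T + 2 :=
    hnorm _ (by simp) (by simp; norm_num) (by simp [abs_of_pos hT0])
  have n2 : ‖(2 - T * I : ℂ) / 2 + 1‖ ≤ T + 2 :=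
    hnorm _ (by simp) (by simp) (by simp [abs_of_pos hT0])
  have n3 : ‖(2 + T * I : ℂ) / 2 + 1‖ ≤ T + 2 :=
    hnorm _ (by simp) (by simp) (by simp [abs_of_pos hT0])
  have n4 : ‖(1 / 2 + T * I : ℂ) / 2 + 1‖ ≤ T + 2 :=
    hnorm _ (by simp) (by simp; norm_num) (by simp [abs_of_pos hT0])
  have key := LogChange.exists_half_hexagon differentiable_riemannXi riemannXi_one_sub
    (x := 1) (by rw [riemannXi_one]; exact one_ne_zero) hT0 (fun ρ hρ ↦ ?_) hS
    (hδ₂.symm.riemannXi hL hexp (by simp) (by simp) n1 n2)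
    (hδ₃.riemannXi hL hexp (by simp) (by simp) n2 n3)
    (hδ₁.riemannXi hL hexp (by simp) (by simp) n3 n4)
  swap
  · obtain ⟨-, h1, h2⟩ := riemannXi_eq_zero_iff_riemannZeta.1 hρ
    exact ⟨h1, h2, hTz ρ hρ⟩
  have e1 : ((1 / 2 + T * I : ℂ) / 2 + 1) = ((5 / 4 : ℝ) : ℂ) + ((T / 2 : ℝ) : ℂ) * I := by
    push_cast; ring
  have e2 : ((1 / 2 - T * I : ℂ) / 2 + 1) = ((5 / 4 : ℝ) : ℂ) - ((T / 2 : ℝ) : ℂ) * I := by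
    push_cast; ring
  have hG := abs_im_sub_im_sub_le (x := 5 / 4) (y := T / 2) (by norm_num) (by positivity)
    (e1 ▸ (hLlim _ (by simp; norm_num) n4).1) (e2 ▸ (hLlim _ (by simp; norm_num) n1).1)
  rw [← e1, ← e2] at hG
  set l := L ((1 / 2 + T * I : ℂ) / 2 + 1)
  set m := L ((1 / 2 - T * I : ℂ) / 2 + 1)
  have him : π * ∑ ρ ∈ S, (analyticOrderNatAt riemannXi ρ : ℝ) =
      δ₁.im - δ₂.im + δ₃.im + (l - m).im - T * Real.log π := by
    have h1 : δ₁ - δ₂ + δ₃ + (l - m) - (T * Real.log π : ℝ) * I =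
        (π * ∑ ρ ∈ S, (analyticOrderNatAt riemannXi ρ : ℝ) : ℝ) * I := by
      push_cast
      linear_combination key
    have h2 := congrArg Complex.im h1
    simp only [Complex.sub_im, Complex.add_im, Complex.im_ofReal_mul, Complex.I_im, mul_one] at h2 ⊢
    linarith
  have hlog : T * Real.log (T / (2 * π)) - T =
      2 * (T / 2 * Real.log (T / 2) - T / 2) - T * Real.log π := by
    rw [← div_div, Real.log_div (by positivity) hpi.ne']
    ring
  have hKT : K ≤ K / Real.log 2 * Real.log T := by
    rw [div_mul_eq_mul_div, le_div_iff₀ hl2]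
    exact mul_le_mul_of_nonneg_left hlT hK.le
  rw [him, hlog, add_mul]
  rw [abs_le] at *
  constructor <;> simp only [K] at hKT ⊢ <;>
    linarith [hG.1, hG.2, hδ₁C.1, hδ₁C.2, hδ₂C.1, hδ₂C.2, hδ₃C.1, hδ₃C.2]

lemma finite_zeros_riemannXi_abs_im_le (T : ℝ) : {ρ | riemannXi ρ = 0 ∧ |ρ.im| ≤ T}.Finite := by
  refine (differentiable_riemannXi.finite_zeros_inter (x := 1) (by rw [riemannXi_one]; exact one_ne_zero)
    (isCompact_closedBall (0 : ℂ) (1 + T))).subset fun ρ hρ ↦ ⟨?_, hρ.1⟩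
  obtain ⟨-, h0, h1⟩ := riemannXi_eq_zero_iff_riemannZeta.1 hρ.1
  rw [mem_closedBall_zero_iff]
  refine (Complex.norm_le_abs_re_add_abs_im ρ).trans (add_le_add ?_ hρ.2)
  rw [abs_of_pos h0]
  exact h1.le

lemma finite_zeros_riemannXi_im (T : ℝ) :
    {ρ | riemannXi ρ = 0 ∧ 0 < ρ.im ∧ ρ.im ≤ T}.Finite :=
  (finite_zeros_riemannXi_abs_im_le T).subset fun ρ hρ ↦
    ⟨hρ.1, (abs_of_pos hρ.2.1).trans_le hρ.2.2⟩

/-- The number of zeros of `ξ` with `0 < Im ρ ≤ T`, counted with multiplicity. -/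
noncomputable def zeroCount (T : ℝ) : ℝ :=
  ∑ ρ ∈ (finite_zeros_riemannXi_im T).toFinset, (analyticOrderNatAt riemannXi ρ : ℝ)

lemma sum_analyticOrderNatAt_riemannXi {T : ℝ} (hT : 0 < T) :
    ∑ ρ ∈ (finite_zeros_riemannXi_abs_im_le T).toFinset, (analyticOrderNatAt riemannXi ρ : ℝ) =
      2 * zeroCount T +
        ∑ ρ ∈ (finite_zeros_riemannXi_abs_im_le 0).toFinset, (analyticOrderNatAt riemannXi ρ : ℝ) := by
  set S := (finite_zeros_riemannXi_abs_im_le T).toFinset with hS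
  have hpos : S.filter (fun ρ ↦ 0 < ρ.im) = (finite_zeros_riemannXi_im T).toFinset := by
    ext ρ
    simp only [hS, Finset.mem_filter, Set.Finite.mem_toFinset, Set.mem_ofPred_eq]
    constructor
    · rintro ⟨⟨h1, h2⟩, h3⟩
      exact ⟨h1, h3, (le_abs_self _).trans h2⟩
    · rintro ⟨h1, h2, h3⟩
      exact ⟨⟨h1, by rwa [abs_of_pos h2]⟩, h2⟩
  have hzero : (S.filter (fun ρ ↦ ¬ 0 < ρ.im)).filter (fun ρ ↦ ¬ ρ.im < 0) =
      (finite_zeros_riemannXi_abs_im_le 0).toFinset := by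
    ext ρ
    simp only [hS, Finset.mem_filter, Set.Finite.mem_toFinset, Set.mem_ofPred_eq, not_lt]
    constructor
    · rintro ⟨⟨⟨h1, h2⟩, h3⟩, h4⟩
      exact ⟨h1, by rw [le_antisymm h3 h4, abs_zero]⟩
    · rintro ⟨h1, h2⟩
      have := abs_nonpos_iff.1 h2
      exact ⟨⟨⟨h1, h2.trans hT.le⟩, this.le⟩, this.ge⟩
  have hneg : ∑ ρ ∈ (S.filter (fun ρ ↦ ¬ 0 < ρ.im)).filter (fun ρ ↦ ρ.im < 0),
      (analyticOrderNatAt riemannXi ρ : ℝ) = zeroCount T := by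
    refine Finset.sum_bij' (fun ρ _ ↦ 1 - ρ) (fun ρ _ ↦ 1 - ρ) ?_ ?_ ?_ ?_ ?_
    · intro ρ hρ
      simp only [hS, Finset.mem_filter, Set.Finite.mem_toFinset, Set.mem_ofPred_eq] at hρ ⊢
      obtain ⟨⟨⟨h1, h2⟩, h3⟩, h4⟩ := hρ
      refine ⟨by rw [riemannXi_one_sub, h1], ?_, ?_⟩
      · simpa using h4
      · simpa [abs_of_neg h4] using h2
    · intro ρ hρ
      simp only [hS, Finset.mem_filter, Set.Finite.mem_toFinset, Set.mem_ofPred_eq] at hρ ⊢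
      obtain ⟨h1, h2, h3⟩ := hρ
      refine ⟨⟨⟨by rw [riemannXi_one_sub, h1], ?_⟩, ?_⟩, ?_⟩
      · simpa [abs_of_pos h2] using h3
      · simpa using h2.le
      · simpa using h2
    · simp
    · simp
    · intro ρ _
      rw [analyticOrderNatAt_riemannXi_one_sub]
  rw [← Finset.sum_filter_add_sum_filter_not S (fun ρ ↦ 0 < ρ.im),
    ← Finset.sum_filter_add_sum_filter_not (S.filter (fun ρ ↦ ¬ 0 < ρ.im)) (fun ρ ↦ ρ.im < 0),
    hpos, hzero, hneg, zeroCount]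
  ring

lemma eventually_zeroCount_eq (T : ℝ) : ∀ᶠ T' in 𝓝[>] T,
    zeroCount T' = zeroCount T ∧ ∀ z, riemannXi z = 0 → 0 < z.im → z.im ≠ T' := by
  have h1 : ∀ᶠ T' in 𝓝[>] T, ∀ z ∈ {ρ | riemannXi ρ = 0 ∧ 0 < ρ.im ∧ ρ.im ≤ T + 1},
      z.im ≤ T ∨ T' < z.im := by
    rw [eventually_all_finite (finite_zeros_riemannXi_im (T + 1))]
    intro z _
    rcases le_or_gt z.im T with h | h
    · exact Eventually.of_forall fun _ ↦ Or.inl h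
    · filter_upwards [nhdsWithin_le_nhds (Iio_mem_nhds h)] with T' hT' using Or.inr hT'
  filter_upwards [h1, self_mem_nhdsWithin, nhdsWithin_le_nhds (Iio_mem_nhds (lt_add_one T))]
    with T' h hT hT1
  rw [Set.mem_Ioi] at hT
  rw [Set.mem_Iio] at hT1
  have key : ∀ z, riemannXi z = 0 → 0 < z.im → z.im ≤ T' → z.im ≤ T := fun z hz h0 hzT ↦
    (h z ⟨hz, h0, hzT.trans hT1.le⟩).resolve_right hzT.not_gt
  constructor
  · unfold zeroCount
    refine Finset.sum_congr ?_ fun _ _ ↦ rfl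
    ext z
    simp only [Set.Finite.mem_toFinset, Set.mem_ofPred_eq]
    exact ⟨fun ⟨h1, h2, h3⟩ ↦ ⟨h1, h2, key z h1 h2 h3⟩, fun ⟨h1, h2, h3⟩ ↦ ⟨h1, h2, h3.trans hT.le⟩⟩
  · intro z hz h0 hzT
    linarith [key z hz h0 hzT.le]

lemma exists_abs_zeroCount_sub_le : ∃ C > 0, ∀ T ≥ (2 : ℝ),
    |zeroCount T - (T / (2 * π) * Real.log (T / (2 * π)) - T / (2 * π))| ≤ C * Real.log T := by
  obtain ⟨C, hC, hcore⟩ := exists_abs_sum_analyticOrderNatAt_riemannXi_sub_le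
  have hl2 : 0 < Real.log 2 := Real.log_pos (by norm_num)
  have hpi := Real.pi_pos
  set n₀ : ℝ := ∑ ρ ∈ (finite_zeros_riemannXi_abs_im_le 0).toFinset,
    (analyticOrderNatAt riemannXi ρ : ℝ)
  have hn₀ : 0 ≤ n₀ := Finset.sum_nonneg fun _ _ ↦ Nat.cast_nonneg _
  have hgen : ∀ T ≥ (2 : ℝ), (∀ z, riemannXi z = 0 → 0 < z.im → z.im ≠ T) →
      |zeroCount T - (T / (2 * π) * Real.log (T / (2 * π)) - T / (2 * π))| ≤
        (C / (2 * π) + n₀ / 2 / Real.log 2) * Real.log T := by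
    intro T hT hTz
    have hTz' : ∀ z, riemannXi z = 0 → |z.im| ≠ T := fun z hz h ↦ by
      rcases lt_trichotomy z.im 0 with h0 | h0 | h0
      · refine hTz (1 - z) (by rw [riemannXi_one_sub, hz]) (by simpa using h0) ?_
        rw [abs_of_neg h0] at h
        simpa using h
      · rw [h0, abs_zero] at h
        linarith
      · exact hTz z hz h0 (by rwa [abs_of_pos h0] at h)
    have h1 := hcore T hT hTz' (finite_zeros_riemannXi_abs_im_le T).toFinset fun ρ ↦ by
      rw [Set.Finite.mem_toFinset, Set.mem_ofPred_eq]
      exact and_congr_right fun h ↦ ⟨fun h2 ↦ lt_of_le_of_ne h2 (hTz' ρ h), le_of_lt⟩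
    rw [sum_analyticOrderNatAt_riemannXi (by linarith)] at h1
    have hlT : Real.log 2 ≤ Real.log T := Real.log_le_log (by norm_num) hT
    have h2 : zeroCount T - (T / (2 * π) * Real.log (T / (2 * π)) - T / (2 * π)) =
        (π * (2 * zeroCount T + n₀) - (T * Real.log (T / (2 * π)) - T)) / (2 * π) - n₀ / 2 := by
      field_simp
      ring
    have h3 : n₀ / 2 ≤ n₀ / 2 / Real.log 2 * Real.log T := by
      rw [div_mul_eq_mul_div _ (Real.log 2), le_div_iff₀ hl2]
      exact mul_le_mul_of_nonneg_left hlT (by positivity)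
    rw [h2, add_mul]
    refine (abs_sub _ _).trans (add_le_add ?_ ?_)
    · rw [abs_div, abs_of_pos (by positivity : 0 < 2 * π), div_mul_eq_mul_div]
      gcongr
    · rwa [abs_of_nonneg (by positivity)]
  refine ⟨C / (2 * π) + n₀ / 2 / Real.log 2, by positivity, fun T hT ↦ ?_⟩
  have hT0 : T ≠ 0 := by linarith
  have hT0' : T / (2 * π) ≠ 0 := by positivity
  have hcont1 : ContinuousAt (fun T' ↦
      |zeroCount T - (T' / (2 * π) * Real.log (T' / (2 * π)) - T' / (2 * π))|) T := by
    fun_prop (disch := assumption)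
  have hcont2 : ContinuousAt (fun T' ↦ (C / (2 * π) + n₀ / 2 / Real.log 2) * Real.log T') T := by
    fun_prop (disch := assumption)
  refine le_of_tendsto_of_tendsto (hcont1.tendsto.mono_left nhdsWithin_le_nhds)
    (hcont2.tendsto.mono_left nhdsWithin_le_nhds) (b := 𝓝[>] T) ?_
  filter_upwards [eventually_zeroCount_eq T, self_mem_nhdsWithin] with T' h hT'
  rw [← h.1]
  exact hgen T' (hT.trans (le_of_lt hT')) h.2

/-- **Riemann–von Mangoldt formula**: letting `N(T)` be the number of nontrivial zeros `ρ`
of the Riemann zeta function with `0 < Im ρ ≤ T`, counted with multiplicity (a finite sum),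
there are constants `C > 0` and `T₀ ≥ 2` such that for all `T ≥ T₀`,
`|N(T) - (T/(2π) log (T/(2π)) - T/(2π))| ≤ C log T`. -/
theorem riemann_vonMangoldt_formula :
    ∃ C > (0 : ℝ), ∃ T₀ ≥ (2 : ℝ), ∀ T ≥ T₀,
      {ρ : ℂ | riemannZeta ρ = 0 ∧ 0 < ρ.re ∧ ρ.re < 1 ∧ 0 < ρ.im ∧ ρ.im ≤ T}.Finite ∧
      |(∑' ρ : {ρ : ℂ | riemannZeta ρ = 0 ∧ 0 < ρ.re ∧ ρ.re < 1 ∧ 0 < ρ.im ∧ ρ.im ≤ T},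
          (zetaZeroMultiplicity ρ : ℝ)) -
        (T / (2 * π) * Real.log (T / (2 * π)) - T / (2 * π))| ≤ C * Real.log T := by
  obtain ⟨C, hC, h⟩ := exists_abs_zeroCount_sub_le
  refine ⟨C, hC, 2, le_rfl, fun T hT ↦ ?_⟩
  have hset : {ρ : ℂ | riemannZeta ρ = 0 ∧ 0 < ρ.re ∧ ρ.re < 1 ∧ 0 < ρ.im ∧ ρ.im ≤ T} =
      {ρ | riemannXi ρ = 0 ∧ 0 < ρ.im ∧ ρ.im ≤ T} := by
    ext ρ
    simp only [Set.mem_ofPred_eq, riemannXi_eq_zero_iff_riemannZeta, and_assoc]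
  have hfin := finite_zeros_riemannXi_im T
  rw [hset]
  refine ⟨hfin, ?_⟩
  have hsum := Finset.tsum_subtype' hfin.toFinset fun ρ ↦ (zetaZeroMultiplicity ρ : ℝ)
  rw [Set.Finite.coe_toFinset] at hsum
  have hcount : zeroCount T = ∑ ρ ∈ hfin.toFinset, (zetaZeroMultiplicity ρ : ℝ) :=
    Finset.sum_congr rfl fun ρ hρ ↦ by
      obtain ⟨-, h0, h1⟩ := riemannXi_eq_zero_iff_riemannZeta.1 (hfin.mem_toFinset.1 hρ).1
      rw [analyticOrderNatAt_riemannXi h0 h1]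
  rw [hsum, ← hcount]
  exact h T hT
end

section
/- (Hadamard explicit formula for the logarithmic derivative of ζ) Let s ∈ ℂ with s ≠ 1 and ζ(s) ≠ 0. Then the family (m_ρ·(1/(s−ρ) + 1/ρ))_ρ, indexed by the nontrivial zeros ρ of ζ with multiplicities m_ρ, is summable, and ζ′(s)/ζ(s) = B − 1/(s−1) + (1/2)·log π − (1/2)·(Γ′/Γ)(s/2 + 1) + Σ_ρ m_ρ·(1/(s−ρ) + 1/ρ), where B = (1/2)·log(4π) − 1 − γ/2 and γ is the Euler–Mascheroni constant. -/
open Real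

section Hadamard

open Filter Topology Metric Set

/-- An entire function factors as `(z - a) ^ n * g z` with `g` entire and `g a ≠ 0`, where `n` is its
order of vanishing at `a`. -/
lemma Differentiable.exists_eq_sub_pow_analyticOrderNatAt_mul {F : ℂ → ℂ} (hF : Differentiable ℂ F)
    {a : ℂ} (ha : analyticOrderAt F a ≠ ⊤) :
    ∃ g : ℂ → ℂ, Differentiable ℂ g ∧ g a ≠ 0 ∧
      ∀ z, F z = (z - a) ^ analyticOrderNatAt F a * g z := by
  obtain ⟨p, hp⟩ := hF.analyticAt a
  have hp0 : p ≠ 0 := fun h ↦ ha (analyticOrderAt_eq_top.mpr (hp.locally_zero_iff.mpr h))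
  have hg : Differentiable ℂ ((Function.swap dslope a)^[p.order] F) := by
    generalize p.order = n
    induction n with
    | zero => exact hF
    | succ n ih =>
      rw [Function.iterate_succ_apply', ← differentiableOn_univ]
      exact (Complex.differentiableOn_dslope univ_mem).mpr ih.differentiableOn
  have hga := hp.iterate_dslope_fslope_ne_zero hp0
  have hn : analyticOrderNatAt F a = p.order :=
    (hp.analyticAt.analyticOrderNatAt_eq_iff ha).mpr
      ⟨_, hg.analyticAt a, hga, .of_forall hp.eq_pow_order_mul_iterate_dslope⟩
  exact ⟨_, hg, hga, fun z ↦ by rw [hn]; exact hp.eq_pow_order_mul_iterate_dslope z⟩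

/-- Finitely many zeros of an entire function can be divided out. -/
lemma Differentiable.exists_eq_prod_one_sub_div_pow_mul {F : ℂ → ℂ} (hF : Differentiable ℂ F)
    (hF0 : F 0 ≠ 0) (S : Finset ℂ) (hS : ∀ ρ ∈ S, ρ ≠ 0) :
    ∃ g : ℂ → ℂ, Differentiable ℂ g ∧ (∀ ρ ∈ S, g ρ ≠ 0) ∧
      ∀ z, F z = (∏ ρ ∈ S, (1 - z / ρ) ^ analyticOrderNatAt F ρ) * g z := by
  induction S using Finset.induction_on with
  | empty => exact ⟨F, hF, by simp, by simp⟩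
  | insert a S ha ih =>
    obtain ⟨g, hg, hgS, hFg⟩ := ih fun ρ hρ ↦ hS ρ (Finset.mem_insert_of_mem hρ)
    have ha0 : a ≠ 0 := hS a (Finset.mem_insert_self a S)
    have hg0 : g 0 ≠ 0 := fun h ↦ hF0 (by rw [hFg, h, mul_zero])
    have hgtop : analyticOrderAt g a ≠ ⊤ := fun h ↦ hg0 <| by
      have := (AnalyticOnNhd.analyticOrderAt_eq_top_iff_eq_zero a
        (fun z ↦ hg.analyticAt z)).mp h
      simp [this]
    have hP : Differentiable ℂ fun z ↦ ∏ ρ ∈ S, (1 - z / ρ) ^ analyticOrderNatAt F ρ := by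
      fun_prop
    have hPa : ∏ ρ ∈ S, (1 - a / ρ) ^ analyticOrderNatAt F ρ ≠ 0 := by
      refine Finset.prod_ne_zero_iff.mpr fun ρ hρ ↦ pow_ne_zero _ fun h ↦ ?_
      have hρ0 := hS ρ (Finset.mem_insert_of_mem hρ)
      rw [sub_eq_zero, eq_comm, div_eq_one_iff_eq hρ0] at h
      exact ha (h ▸ hρ)
    have hord : analyticOrderNatAt F a = analyticOrderNatAt g a := by
      have : F = (fun z ↦ ∏ ρ ∈ S, (1 - z / ρ) ^ analyticOrderNatAt F ρ) * g := funext hFg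
      rw [analyticOrderNatAt, analyticOrderNatAt, this,
        analyticOrderAt_mul (hP.analyticAt a) (hg.analyticAt a),
        (hP.analyticAt a).analyticOrderAt_eq_zero.mpr hPa, zero_add]
    obtain ⟨h, hh, hha, hgh⟩ := hg.exists_eq_sub_pow_analyticOrderNatAt_mul hgtop
    refine ⟨fun z ↦ (-a) ^ analyticOrderNatAt F a * h z, by fun_prop, ?_, fun z ↦ ?_⟩
    · have hna : (-a) ^ analyticOrderNatAt F a ≠ 0 := pow_ne_zero _ (neg_ne_zero.mpr ha0)
      intro ρ hρ
      rcases Finset.mem_insert.mp hρ with rfl | hρ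
      · exact mul_ne_zero hna hha
      · refine mul_ne_zero hna fun h0 ↦ hgS ρ hρ ?_
        rw [hgh, h0, mul_zero]
    · have : z - a = (1 - z / a) * (-a) := by field_simp; ring
      rw [Finset.prod_insert ha]
      nth_rw 1 [hFg z, hgh z]
      rw [← hord, this, mul_pow]
      ring

/-- If `g` has no zeros in the disc of radius `R` around the origin, `g 0 = 1`, and
`‖g‖ ≤ Real.exp M` there, then the logarithmic derivative of `g` varies little near the origin. -/
lemma norm_logDeriv_sub_logDeriv_zero_le {g : ℂ → ℂ} (hg : Differentiable ℂ g) {R M : ℝ}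
    (hM : 0 < M) (hg0 : g 0 = 1) (hgne : ∀ z ∈ ball (0 : ℂ) R, g z ≠ 0)
    (hgM : ∀ z ∈ ball (0 : ℂ) R, ‖g z‖ ≤ Real.exp M) {z : ℂ} (hz : ‖z‖ < R / 4) :
    ‖logDeriv g z - logDeriv g 0‖ ≤ 64 * M * ‖z‖ / R ^ 2 := by
  have hR : 0 < R := by linarith [norm_nonneg z]
  have hd : DifferentiableOn ℂ (logDeriv g) (ball 0 R) :=
    (hg.deriv.differentiableOn).div hg.differentiableOn hgne
  obtain ⟨h, h0, hh⟩ := hd.isExactOn_ball.with_val_at 0 0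
  have hhd : DifferentiableOn ℂ h (ball 0 R) :=
    fun w hw ↦ (hh w hw).differentiableAt.differentiableWithinAt
  have h0R : (0 : ℂ) ∈ ball 0 R := mem_ball_self hR
  have hexp : ∀ w ∈ ball (0 : ℂ) R, Complex.exp (h w) = g w := by
    have hd1 : DifferentiableOn ℂ (fun w ↦ Complex.exp (-h w) * g w) (ball 0 R) :=
      hhd.neg.cexp.mul hg.differentiableOn
    have hd0 : EqOn (deriv fun w ↦ Complex.exp (-h w) * g w) 0 (ball 0 R) := fun w hw ↦ by
      refine ((hh w hw).neg.cexp.mul (hg w).hasDerivAt).deriv.trans ?_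
      have := hgne w hw
      simp only [logDeriv_apply, Pi.zero_apply, Pi.neg_apply]
      field_simp
      ring
    intro w hw
    have := isOpen_ball.is_const_of_deriv_eq_zero (convex_ball (0 : ℂ) R).isPreconnected hd1 hd0
      hw h0R
    simp only [h0, hg0, neg_zero, Complex.exp_zero, mul_one] at this
    rw [Complex.exp_neg, inv_mul_eq_one₀ (Complex.exp_ne_zero _)] at this
    exact this
  have hre : MapsTo h (ball 0 R) {w | w.re ≤ M} := fun w hw ↦ by
    have := hgM w hw
    rwa [← hexp w hw, Complex.norm_exp, Real.exp_le_exp] at this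
  have hbound : ∀ w : ℂ, ‖w‖ ≤ R / 2 → ‖h w‖ ≤ 2 * M := fun w hw ↦ by
    refine (Complex.borelCaratheodory_zero hM hhd hre hR (by simp; linarith) h0).trans ?_
    rw [div_le_iff₀ (by linarith)]
    nlinarith
  have hderiv : ∀ w ∈ ball (0 : ℂ) (R / 4), ‖logDeriv g w‖ ≤ 8 * M / R := fun w hw ↦ by
    rw [mem_ball_zero_iff] at hw
    have hsub : closedBall w (R / 4) ⊆ ball 0 R := fun x hx ↦ by
      rw [mem_closedBall, dist_eq_norm] at hx
      rw [mem_ball_zero_iff]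
      have := norm_add_le (x - w) w
      rw [sub_add_cancel] at this
      linarith
    rw [← (hh w (by simp; linarith)).deriv]
    refine (Complex.norm_deriv_le_of_forall_mem_sphere_norm_le (C := 2 * M)
      (show 0 < R / 4 by linarith) ?_ ?_).trans_eq ?_
    · exact (hhd.mono (closure_ball_subset_closedBall.trans hsub)).diffContOnCl
    · intro x hx
      refine hbound x ?_
      rw [mem_sphere, dist_eq_norm] at hx
      have := norm_add_le (x - w) w
      rw [sub_add_cancel] at this
      linarith
    · field_simp
      norm_num
  have h4 : ball (0 : ℂ) (R / 4) ⊆ ball 0 R := ball_subset_ball (by linarith)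
  have hmaps : MapsTo (logDeriv g) (ball 0 (R / 4)) (closedBall (logDeriv g 0) (16 * M / R)) :=
    fun w hw ↦ by
      rw [mem_closedBall, dist_eq_norm]
      refine (norm_sub_le _ _).trans ((add_le_add (hderiv w hw)
        (hderiv 0 (mem_ball_self (by linarith)))).trans_eq ?_)
      ring
  have := Complex.dist_le_div_mul_dist_of_mapsTo_ball (hd.mono h4) hmaps
    (mem_ball_zero_iff.mpr hz)
  rw [dist_eq_norm, dist_zero_right] at this
  refine this.trans_eq ?_
  field_simp
  ring

/-- Dividing out zeros of modulus at most `R` lowers the size of an entire function on the disc of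
radius `4 * R` by a factor `3` for every zero. -/
lemma norm_le_exp_sub_of_eq_prod_mul {F g : ℂ → ℂ} (hg : Differentiable ℂ g) {S : Finset ℂ}
    {m : ℂ → ℕ} (hFg : ∀ z, F z = (∏ ρ ∈ S, (1 - z / ρ) ^ m ρ) * g z)
    {R M : ℝ} (hR : 0 < R) (hS0 : ∀ ρ ∈ S, ρ ≠ 0) (hSR : ∀ ρ ∈ S, ‖ρ‖ ≤ R)
    (hM : ∀ z : ℂ, ‖z‖ ≤ 4 * R → ‖F z‖ ≤ Real.exp M) {z : ℂ} (hz : ‖z‖ ≤ 4 * R) :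
    ‖g z‖ ≤ Real.exp (M - ∑ ρ ∈ S, (m ρ : ℝ)) := by
  have hfr : ∀ w ∈ frontier (ball (0 : ℂ) (4 * R)), ‖g w‖ ≤ Real.exp (M - ∑ ρ ∈ S, (m ρ : ℝ)) := by
    intro w hw
    rw [frontier_ball _ (by positivity), mem_sphere_zero_iff_norm] at hw
    have h3 : Real.exp (∑ ρ ∈ S, (m ρ : ℝ)) ≤ ‖∏ ρ ∈ S, (1 - w / ρ) ^ m ρ‖ := by
      rw [Real.exp_sum, norm_prod]
      refine Finset.prod_le_prod (fun _ _ ↦ (Real.exp_pos _).le) fun ρ hρ ↦ ?_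
      rw [norm_pow, ← mul_one (m ρ : ℝ), Real.exp_nat_mul]
      gcongr
      refine (Real.exp_one_lt_d9.le.trans (by norm_num : _ ≤ (3 : ℝ))).trans ?_
      have hρ0 : 0 < ‖ρ‖ := norm_pos_iff.mpr (hS0 ρ hρ)
      have h1 := norm_sub_norm_le (w / ρ) 1
      rw [norm_sub_rev, norm_div, hw, norm_one] at h1
      have : 4 ≤ 4 * R / ‖ρ‖ := by
        rw [le_div_iff₀ hρ0]
        linarith [hSR ρ hρ]
      linarith
    have hF := hM w hw.le
    rw [hFg, norm_mul] at hF
    rw [Real.exp_sub, le_div_iff₀ (Real.exp_pos _), mul_comm]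
    exact (mul_le_mul_of_nonneg_right h3 (norm_nonneg _)).trans hF
  refine Complex.norm_le_of_forall_mem_frontier_norm_le isBounded_ball hg.diffContOnCl hfr ?_
  rwa [closure_ball _ (by positivity), mem_closedBall_zero_iff]

/-- The number of zeros (with multiplicity) of modulus at most `R` is bounded in terms of the size
of the function on the disc of radius `4 * R`. -/
lemma sum_analyticOrderNatAt_le {F : ℂ → ℂ} (hF : Differentiable ℂ F) (hF0 : F 0 = 1)
    {S : Finset ℂ} {R M : ℝ} (hR : 0 < R) (hS : ∀ ρ ∈ S, F ρ = 0) (hSR : ∀ ρ ∈ S, ‖ρ‖ ≤ R)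
    (hM : ∀ z : ℂ, ‖z‖ ≤ 4 * R → ‖F z‖ ≤ Real.exp M) :
    ∑ ρ ∈ S, (analyticOrderNatAt F ρ : ℝ) ≤ M := by
  have hS0 : ∀ ρ ∈ S, ρ ≠ 0 := fun ρ hρ h ↦ by
    have := hS ρ hρ
    rw [h, hF0] at this
    exact one_ne_zero this
  obtain ⟨g, hg, -, hFg⟩ := hF.exists_eq_prod_one_sub_div_pow_mul (hF0 ▸ one_ne_zero) S hS0
  have h0 := norm_le_exp_sub_of_eq_prod_mul hg hFg hR hS0 hSR hM (z := 0) (by simp [hR.le])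
  have hg0 : g 0 = 1 := by simpa [hF0] using (hFg 0).symm
  rw [hg0, norm_one, Real.one_le_exp_iff] at h0
  linarith

lemma Differentiable.finite_zeros_norm_le {F : ℂ → ℂ} (hF : Differentiable ℂ F) {w : ℂ}
    (hw : F w ≠ 0) (R : ℝ) : {ρ : {ρ : ℂ // F ρ = 0} | ‖ρ.1‖ ≤ R}.Finite := by
  have h : F ⁻¹' {0}ᶜ ∈ codiscrete ℂ :=
    AnalyticOnNhd.preimage_zero_mem_codiscrete (fun z _ ↦ hF.analyticAt z) hw
  obtain ⟨hopen, hdisc⟩ := mem_codiscrete'.mp h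
  have hcl : IsClosed {ρ | F ρ = 0} := isClosed_eq hF.continuous continuous_const
  have hdisc' : IsDiscrete {ρ | F ρ = 0} := by
    convert hdisc using 1
    ext ρ
    simp
  have hfin := ((isCompact_closedBall (0 : ℂ) R).inter_right hcl).finite
    (hdisc'.mono inter_subset_right)
  refine (hfin.preimage Subtype.val_injective.injOn).subset fun ρ hρ ↦ ?_
  exact ⟨mem_closedBall_zero_iff.mpr hρ, ρ.2⟩

/-- A function of growth order less than `2` has zeros `ρ` with `∑ 1 / (1 + |ρ|) ^ 2` finite. -/
lemma summable_analyticOrderNatAt_div_sq {F : ℂ → ℂ} (hF : Differentiable ℂ F) (hF0 : F 0 = 1)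
    {α C : ℝ} (hα : α < 2)
    (hgrowth : ∀ R : ℝ, 1 ≤ R → ∀ z : ℂ, ‖z‖ ≤ R → ‖F z‖ ≤ Real.exp (C * R ^ α)) :
    Summable fun ρ : {ρ : ℂ // F ρ = 0} ↦ (analyticOrderNatAt F ρ : ℝ) / (1 + ‖ρ.1‖) ^ 2 := by
  classical
  have hr0 : (0 : ℝ) ≤ 2 ^ (α - 2) := by positivity
  have hr1 : (2 : ℝ) ^ (α - 2) < 1 := Real.rpow_lt_one_of_one_lt_of_neg one_lt_two (by linarith)
  have hC : 0 ≤ C := by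
    have := hgrowth 1 le_rfl 0 (by simp)
    rwa [hF0, norm_one, Real.one_le_exp_iff, Real.one_rpow, mul_one] at this
  have hgeom : Summable fun k : ℕ ↦ C * 8 ^ α * ((2 : ℝ) ^ (α - 2)) ^ k :=
    (summable_geometric_of_lt_one hr0 hr1).mul_left _
  let κ : {ρ : ℂ // F ρ = 0} → ℕ := fun ρ ↦ Nat.log 2 ⌊‖ρ.1‖⌋₊
  have hκ_up : ∀ ρ, ‖ρ.1‖ ≤ 2 ^ (κ ρ + 1) := fun ρ ↦ by
    have h1 := Nat.lt_pow_succ_log_self one_lt_two ⌊‖ρ.1‖⌋₊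
    have h2 : ((⌊‖ρ.1‖⌋₊ + 1 : ℕ) : ℝ) ≤ ((2 ^ (κ ρ + 1) : ℕ) : ℝ) := Nat.cast_le.mpr h1
    push_cast at h2
    exact (Nat.lt_floor_add_one _).le.trans h2
  have hκ_low : ∀ ρ, 2 ^ κ ρ ≤ 1 + ‖ρ.1‖ := fun ρ ↦ by
    rcases eq_or_ne ⌊‖ρ.1‖⌋₊ 0 with h | h
    · simp [κ, h]
    · have h1 : ((2 ^ κ ρ : ℕ) : ℝ) ≤ (⌊‖ρ.1‖⌋₊ : ℝ) := Nat.cast_le.mpr (Nat.pow_log_le_self 2 h)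
      push_cast at h1
      linarith [Nat.floor_le (norm_nonneg ρ.1)]
  refine summable_of_sum_le (c := ∑' k : ℕ, C * 8 ^ α * ((2 : ℝ) ^ (α - 2)) ^ k)
    (fun ρ ↦ by positivity) fun T ↦ ?_
  rw [← Finset.sum_fiberwise_of_maps_to (t := T.image κ) (g := κ)
    fun ρ hρ ↦ Finset.mem_image_of_mem κ hρ]
  refine (Finset.sum_le_sum fun k _ ↦ ?_).trans
    (hgeom.sum_le_tsum (T.image κ) fun k _ ↦ by positivity)
  have hcount : ∑ ρ ∈ T with κ ρ = k, (analyticOrderNatAt F ρ.1 : ℝ) ≤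
      C * (4 * 2 ^ (k + 1) : ℝ) ^ α := by
    have := sum_analyticOrderNatAt_le hF hF0 (R := 2 ^ (k + 1)) (by positivity)
      (S := {ρ ∈ T | κ ρ = k}.map (Function.Embedding.subtype _)) ?_ ?_ (hgrowth _ ?_)
    · rwa [Finset.sum_map] at this
    · simp only [Finset.mem_map]
      rintro _ ⟨ρ, -, rfl⟩
      exact ρ.2
    · simp only [Finset.mem_map, Finset.mem_filter]
      rintro _ ⟨ρ, ⟨-, rfl⟩, rfl⟩
      exact hκ_up ρ
    · have : (1 : ℝ) ≤ 2 ^ (k + 1) := one_le_pow₀ one_le_two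
      linarith
  calc ∑ ρ ∈ T with κ ρ = k, (analyticOrderNatAt F ρ.1 : ℝ) / (1 + ‖ρ.1‖) ^ 2
      ≤ ∑ ρ ∈ T with κ ρ = k, (analyticOrderNatAt F ρ.1 : ℝ) / (2 ^ k) ^ 2 := by
        refine Finset.sum_le_sum fun ρ hρ ↦ ?_
        have h1 := hκ_low ρ
        rw [(Finset.mem_filter.mp hρ).2] at h1
        gcongr
    _ ≤ C * (4 * 2 ^ (k + 1) : ℝ) ^ α / (2 ^ k) ^ 2 := by
        rw [← Finset.sum_div]
        gcongr
    _ = C * 8 ^ α * ((2 : ℝ) ^ (α - 2)) ^ k := by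
        have h8 : (4 * 2 ^ (k + 1) : ℝ) = 8 * 2 ^ k := by ring
        have h2 : (((2 : ℝ) ^ k) ^ 2) = (2 ^ (2 : ℝ)) ^ k := by
          rw [Real.rpow_two, ← pow_mul, ← pow_mul, mul_comm]
        have h3 : ((2 : ℝ) ^ k) ^ α = (2 ^ α) ^ k := by
          rw [← Real.rpow_natCast, ← Real.rpow_natCast, ← Real.rpow_mul two_pos.le,
            ← Real.rpow_mul two_pos.le, mul_comm]
        rw [h8, Real.mul_rpow (by positivity) (by positivity), h2, h3,
          Real.rpow_sub two_pos, div_pow]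
        ring

lemma Differentiable.summable_zeros {F : ℂ → ℂ} (hF : Differentiable ℂ F) (hF0 : F 0 = 1)
    {α C : ℝ} (hα : α < 2)
    (hgrowth : ∀ R : ℝ, 1 ≤ R → ∀ z : ℂ, ‖z‖ ≤ R → ‖F z‖ ≤ Real.exp (C * R ^ α)) (s : ℂ) :
    Summable fun ρ : {ρ : ℂ // F ρ = 0} ↦
      (analyticOrderNatAt F ρ : ℂ) * (1 / (s - ρ) + 1 / ρ) := by
  refine ((summable_analyticOrderNatAt_div_sq hF hF0 hα hgrowth).mul_left
    (8 * ‖s‖)).of_norm_bounded_eventually ?_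
  refine (hF.finite_zeros_norm_le (w := 0) (by simp [hF0]) (2 * ‖s‖ + 1)).subset fun ρ hρ ↦ ?_
  by_contra hlt
  refine hρ ?_
  simp only [mem_ofPred_eq, not_le] at hlt ⊢
  have hs := norm_nonneg s
  have hρ0 : 0 < ‖ρ.1‖ := by linarith
  have h1 : ‖ρ.1‖ / 2 ≤ ‖s - ρ.1‖ := by
    have := norm_sub_norm_le ρ.1 s
    rw [norm_sub_rev] at this
    linarith
  have h2 : 0 < ‖s - ρ.1‖ := by linarith
  have h3 : 1 / (s - ρ.1) + 1 / ρ.1 = s / ((s - ρ.1) * ρ.1) := by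
    have := norm_pos_iff.mp h2
    have := norm_pos_iff.mp hρ0
    field_simp
    ring
  rw [h3, norm_mul, Complex.norm_natCast, norm_div, norm_mul, ← mul_div_assoc, ← mul_div_assoc,
    div_le_div_iff₀ (by positivity) (by positivity)]
  have h4 : (1 + ‖ρ.1‖) ^ 2 ≤ 8 * (‖s - ρ.1‖ * ‖ρ.1‖) := by nlinarith
  nlinarith [mul_le_mul_of_nonneg_left h4
    (by positivity : 0 ≤ (analyticOrderNatAt F ρ : ℝ) * ‖s‖)]

/-- **Hadamard's theorem** in logarithmic derivative form, for entire functions of order less than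
`2`. -/
theorem Differentiable.hasSum_logDeriv_sub {F : ℂ → ℂ} (hF : Differentiable ℂ F) (hF0 : F 0 = 1)
    {α C : ℝ} (hα : α < 2)
    (hgrowth : ∀ R : ℝ, 1 ≤ R → ∀ z : ℂ, ‖z‖ ≤ R → ‖F z‖ ≤ Real.exp (C * R ^ α))
    {s : ℂ} (hs : F s ≠ 0) :
    HasSum (fun ρ : {ρ : ℂ // F ρ = 0} ↦
      (analyticOrderNatAt F ρ : ℂ) * (1 / (s - ρ) + 1 / ρ)) (logDeriv F s - logDeriv F 0) := by
  classical
  have hC : 0 ≤ C := by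
    have := hgrowth 1 le_rfl 0 (by simp)
    rwa [hF0, norm_one, Real.one_le_exp_iff, Real.one_rpow, mul_one] at this
  have hC1 : 0 < C + 1 := by linarith
  have hfin := hF.finite_zeros_norm_le (w := 0) (by simp [hF0])
  let T : ℕ → Finset {ρ : ℂ // F ρ = 0} := fun n ↦ (hfin n).toFinset
  have hT : Tendsto T atTop atTop := by
    refine tendsto_atTop_finset_of_monotone (fun a b hab ρ hρ ↦ ?_) fun ρ ↦ ?_
    · simp only [T, Finite.mem_toFinset, mem_ofPred_eq] at hρ ⊢
      exact hρ.trans (Nat.cast_le.mpr hab)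
    · obtain ⟨n, hn⟩ := exists_nat_ge ‖ρ.1‖
      exact ⟨n, by simpa [T] using hn⟩
  have hsum := (hF.summable_zeros hF0 hα hgrowth s).hasSum
  have hlim := hsum.comp hT
  suffices h : Tendsto (fun n ↦ logDeriv F s - logDeriv F 0 - ∑ ρ ∈ T n,
      (analyticOrderNatAt F ρ : ℂ) * (1 / (s - ρ) + 1 / ρ)) atTop (𝓝 0) by
    rw [← sub_eq_zero.mp (tendsto_nhds_unique (tendsto_const_nhds.sub hlim) h)] at hsum
    exact hsum
  have hbound : ∀ᶠ n : ℕ in atTop, ‖logDeriv F s - logDeriv F 0 - ∑ ρ ∈ T n,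
      (analyticOrderNatAt F ρ : ℂ) * (1 / (s - ρ) + 1 / ρ)‖ ≤
      64 * (C + 1) * 4 ^ α * ‖s‖ * (n : ℝ) ^ (-(2 - α)) := by
    obtain ⟨N, hN⟩ := exists_nat_gt (4 * ‖s‖)
    filter_upwards [eventually_ge_atTop N, eventually_ge_atTop 1] with n hnN hn1
    have hn : (1 : ℝ) ≤ n := by exact_mod_cast hn1
    have hsn : ‖s‖ < n / 4 := by
      have : (N : ℝ) ≤ n := Nat.cast_le.mpr hnN
      linarith
    set S : Finset ℂ := (T n).map (Function.Embedding.subtype _) with hSdef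
    have hSmem : ∀ ρ, ρ ∈ S ↔ F ρ = 0 ∧ ‖ρ‖ ≤ n := fun ρ ↦ by simp [S, T, and_comm]
    have hS0 : ∀ ρ ∈ S, ρ ≠ 0 := fun ρ hρ h ↦ by
      have := ((hSmem ρ).mp hρ).1
      rw [h, hF0] at this
      exact one_ne_zero this
    obtain ⟨g, hg, hgS, hFg⟩ := hF.exists_eq_prod_one_sub_div_pow_mul (hF0 ▸ one_ne_zero) S hS0
    have hM : ∀ z : ℂ, ‖z‖ ≤ 4 * n → ‖F z‖ ≤ Real.exp ((C + 1) * (4 * n) ^ α) := fun z hz ↦ by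
      refine (hgrowth (4 * n) (by linarith) z hz).trans (Real.exp_le_exp.mpr ?_)
      gcongr
      linarith
    have hg0 : g 0 = 1 := by simpa [hF0] using (hFg 0).symm
    have hgM : ∀ z ∈ ball (0 : ℂ) n, ‖g z‖ ≤ Real.exp ((C + 1) * (4 * n) ^ α) := fun z hz ↦ by
      rw [mem_ball_zero_iff] at hz
      refine (norm_le_exp_sub_of_eq_prod_mul hg hFg (by linarith : (0 : ℝ) < n) hS0
        (fun ρ hρ ↦ ((hSmem ρ).mp hρ).2) hM (by linarith)).trans (Real.exp_le_exp.mpr ?_)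
      exact sub_le_self _ (by positivity)
    have hgne : ∀ z ∈ ball (0 : ℂ) n, g z ≠ 0 := fun z hz h ↦ by
      rw [mem_ball_zero_iff] at hz
      exact hgS z ((hSmem z).mpr ⟨by rw [hFg, h, mul_zero], hz.le⟩) h
    have hlog : ∀ z : ℂ, F z ≠ 0 →
        logDeriv F z = ∑ ρ ∈ S, (analyticOrderNatAt F ρ : ℂ) * (1 / (z - ρ)) + logDeriv g z := by
      intro z hz
      have hz' := hz
      rw [hFg] at hz'
      have hne := Finset.prod_ne_zero_iff.mp (left_ne_zero_of_mul hz')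
      rw [congrArg (logDeriv · z) (funext hFg), logDeriv_mul z (left_ne_zero_of_mul hz') (right_ne_zero_of_mul hz')
        (by fun_prop) (hg z), logDeriv_prod hne fun _ _ ↦ by fun_prop]
      congr 1
      refine Finset.sum_congr rfl fun ρ hρ ↦ ?_
      rw [logDeriv_fun_pow (by fun_prop), logDeriv_apply]
      congr 1
      have hρ0 := hS0 ρ hρ
      have hzρ : z - ρ ≠ 0 := fun h ↦ hz (by rw [sub_eq_zero.mp h]; exact ((hSmem ρ).mp hρ).1)
      have h1 : 1 - z / ρ ≠ 0 := fun h ↦ hzρ (by field_simp at h; linear_combination -h)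
      have h2 : _root_.deriv (fun z ↦ 1 - z / ρ) z = -(1 / ρ) := by simp
      rw [h2, div_eq_div_iff h1 hzρ]
      field_simp
      ring
    have hdiff : logDeriv F s - logDeriv F 0 - ∑ ρ ∈ T n,
        (analyticOrderNatAt F ρ : ℂ) * (1 / (s - ρ) + 1 / ρ) = logDeriv g s - logDeriv g 0 := by
      have hTS : ∑ ρ ∈ T n, (analyticOrderNatAt F ρ : ℂ) * (1 / (s - ρ) + 1 / ρ) =
          ∑ ρ ∈ S, (analyticOrderNatAt F ρ : ℂ) * (1 / (s - ρ) + 1 / ρ) := by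
        rw [hSdef, Finset.sum_map]; rfl
      rw [hTS, hlog s hs, hlog 0 (hF0 ▸ one_ne_zero)]
      simp only [mul_add, Finset.sum_add_distrib, zero_sub, one_div, inv_neg, mul_neg,
        Finset.sum_neg_distrib]
      ring
    rw [hdiff]
    refine (norm_logDeriv_sub_logDeriv_zero_le hg (by positivity) hg0 hgne hgM hsn).trans_eq ?_
    rw [Real.mul_rpow (by norm_num) (by positivity), neg_sub, Real.rpow_sub (by linarith),
      Real.rpow_two]
    ring
  refine squeeze_zero_norm' hbound ?_
  simpa using ((tendsto_rpow_neg_atTop (by linarith : 0 < 2 - α)).comp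
    tendsto_natCast_atTop_atTop).const_mul (64 * (C + 1) * 4 ^ α * ‖s‖)

end Hadamard

section RiemannXi

open Filter Topology Metric Set MeasureTheory

lemma norm_mellin_le {f : ℝ → ℂ} {a b : ℝ} (ha : MellinConvergent f a) (hb : MellinConvergent f b)
    {s : ℂ} (has : a ≤ s.re) (hsb : s.re ≤ b) :
    ‖mellin f s‖ ≤ ∫ t in Ioi (0 : ℝ), (t ^ (a - 1) * ‖f t‖ + t ^ (b - 1) * ‖f t‖) := by
  have hnorm : ∀ {z : ℂ} {t : ℝ}, t ∈ Ioi (0 : ℝ) →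
      ‖(t : ℂ) ^ (z - 1) • f t‖ = t ^ (z.re - 1) * ‖f t‖ := fun {z t} ht ↦ by
    rw [norm_smul, Complex.norm_cpow_eq_rpow_re_of_pos ht, Complex.sub_re, Complex.one_re]
  have hint : ∀ {c : ℝ}, MellinConvergent f c →
      IntegrableOn (fun t : ℝ ↦ t ^ (c - 1) * ‖f t‖) (Ioi 0) := fun {c} hc ↦
    (Integrable.norm hc).congr
      ((ae_restrict_iff' measurableSet_Ioi).mpr (.of_forall fun t ht ↦ hnorm ht))
  refine norm_integral_le_of_norm_le ((hint ha).add (hint hb))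
    ((ae_restrict_iff' measurableSet_Ioi).mpr (.of_forall fun t ht ↦ ?_))
  rw [hnorm ht, ← add_mul]
  refine mul_le_mul_of_nonneg_right ?_ (norm_nonneg _)
  have ht0 : (0 : ℝ) < t := ht
  rcases le_total 1 t with h | h
  · exact (Real.rpow_le_rpow_of_exponent_le h (by linarith)).trans
      (le_add_of_nonneg_left (Real.rpow_nonneg ht0.le _))
  · exact (Real.rpow_le_rpow_of_exponent_ge ht0 h (by linarith)).trans
      (le_add_of_nonneg_right (Real.rpow_nonneg ht0.le _))

lemma exists_norm_completedRiemannZeta₀_le (a b : ℝ) :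
    ∃ K : ℝ, 0 ≤ K ∧ ∀ s : ℂ, a ≤ s.re → s.re ≤ b → ‖completedRiemannZeta₀ s‖ ≤ K := by
  let P := HurwitzZeta.hurwitzEvenFEPair 0
  have hP : ∀ z : ℂ, MellinConvergent P.f_modif z :=
    fun z ↦ (P.isStrongFEPair_toStrongFEPair.hasMellin z).1
  refine ⟨|(∫ t in Ioi (0 : ℝ), (t ^ (a / 2 - 1) * ‖P.f_modif t‖ +
    t ^ (b / 2 - 1) * ‖P.f_modif t‖)) / 2|, abs_nonneg _, fun s ha hb ↦ ?_⟩
  have hs : completedRiemannZeta₀ s = mellin P.f_modif (s / 2) / 2 := rfl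
  have hre : (s / 2).re = s.re / 2 := by simp
  rw [hs, norm_div, Complex.norm_ofNat]
  refine le_trans ?_ (le_abs_self _)
  gcongr
  exact norm_mellin_le (hP _) (hP _) (by rw [hre]; linarith) (by rw [hre]; linarith)

lemma Complex.norm_Gamma_le {s : ℂ} (hs : 0 < s.re) : ‖Complex.Gamma s‖ ≤ Real.Gamma s.re := by
  rw [Complex.Gamma_eq_integral hs, Real.Gamma_eq_integral hs, Complex.GammaIntegral]
  refine (norm_integral_le_integral_norm _).trans_eq
    (setIntegral_congr_fun measurableSet_Ioi fun x hx ↦ ?_)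
  simp [Complex.norm_cpow_eq_rpow_re_of_pos hx, -Complex.ofReal_exp]

lemma Real.Gamma_le_exp_rpow {x R : ℝ} (hx : 1 ≤ x) (hxR : x ≤ R) :
    Real.Gamma x ≤ Real.exp (8 * (2 * R) ^ (3 / 2 : ℝ)) := by
  set n := ⌈R⌉₊ with hn
  have hRn : R ≤ n := Nat.le_ceil R
  have hnR : (n : ℝ) ≤ 2 * R := by
    have := Nat.ceil_lt_add_one (by linarith : 0 ≤ R)
    linarith
  have hn1 : (1 : ℝ) ≤ n := by linarith
  have h1 : Real.Gamma x ≤ Real.Gamma (x + 1) := by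
    rw [Real.Gamma_add_one (by linarith)]
    exact le_mul_of_one_le_left (Real.Gamma_nonneg_of_nonneg (by linarith)) hx
  have h2 : Real.Gamma (x + 1) ≤ Real.Gamma (n + 1) :=
    Real.Gamma_strictMonoOn_Ici.monotoneOn (mem_Ici.mpr (by linarith)) (mem_Ici.mpr (by linarith))
      (by linarith)
  have h3 : Real.Gamma (n + 1) ≤ (n : ℝ) ^ n := by
    rw [Real.Gamma_nat_eq_factorial]
    exact_mod_cast Nat.factorial_le_pow n
  refine (h1.trans (h2.trans h3)).trans ?_
  rw [← Real.rpow_natCast, Real.rpow_def_of_pos (by linarith)]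
  refine Real.exp_le_exp.mpr ?_
  have hlog : Real.log n ≤ (n : ℝ) ^ (1 / 2 : ℝ) / (1 / 2) :=
    Real.log_le_rpow_div (by linarith) (by norm_num)
  have h4 : (n : ℝ) ^ (3 / 2 : ℝ) = n ^ (1 / 2 : ℝ) * n := by
    rw [← Real.rpow_add_one (by linarith)]
    norm_num
  have h5 : (n : ℝ) ^ (3 / 2 : ℝ) ≤ (2 * R) ^ (3 / 2 : ℝ) := by gcongr
  have h6 : 0 ≤ (n : ℝ) ^ (1 / 2 : ℝ) := by positivity
  nlinarith

lemma exists_norm_completedRiemannZeta_le :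
    ∃ Z : ℝ, 0 ≤ Z ∧ ∀ s : ℂ, 2 ≤ s.re → ‖completedRiemannZeta s‖ ≤ Real.Gamma (s.re / 2) * Z := by
  have hsum : Summable fun n : ℕ ↦ 1 / (n : ℝ) ^ 2 := Real.summable_one_div_nat_pow.mpr one_lt_two
  refine ⟨∑' n : ℕ, 1 / (n : ℝ) ^ 2, by positivity, fun s hs ↦ ?_⟩
  rw [completedZeta_eq_tsum_of_one_lt_re (by linarith), norm_mul, norm_mul]
  gcongr
  · have hpi : ‖(π : ℂ) ^ (-s / 2)‖ ≤ 1 := by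
      rw [Complex.norm_cpow_eq_rpow_re_of_pos Real.pi_pos]
      refine Real.rpow_le_one_of_one_le_of_nonpos (by linarith [Real.pi_gt_three]) ?_
      simp only [Complex.div_ofNat_re, Complex.neg_re]
      linarith
    have hG := Complex.norm_Gamma_le (s := s / 2) (by simp; linarith)
    rw [Complex.div_ofNat_re] at hG
    exact (mul_le_of_le_one_left (norm_nonneg _) hpi).trans hG
  · refine tsum_of_norm_bounded hsum.hasSum fun n ↦ ?_
    rcases n.eq_zero_or_pos with rfl | hn
    · rw [Nat.cast_zero, Complex.zero_cpow (by rintro rfl; norm_num at hs)]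
      simp
    · rw [norm_div, norm_one, Complex.norm_natCast_cpow_of_pos hn, ← Real.rpow_natCast]
      gcongr
      · exact_mod_cast hn
      · exact_mod_cast hs

/-- The entire function `s (s - 1) Λ(s)`, which is twice the Riemann `ξ` function. -/
noncomputable def entireRiemannXi (s : ℂ) : ℂ := s * (s - 1) * completedRiemannZeta₀ s + 1

lemma differentiable_entireRiemannXi : Differentiable ℂ entireRiemannXi := by
  have := differentiable_completedZeta₀
  unfold entireRiemannXi
  fun_prop

@[simp] lemma entireRiemannXi_zero : entireRiemannXi 0 = 1 := by simp [entireRiemannXi]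

@[simp] lemma entireRiemannXi_one : entireRiemannXi 1 = 1 := by simp [entireRiemannXi]

lemma entireRiemannXi_one_sub (s : ℂ) : entireRiemannXi (1 - s) = entireRiemannXi s := by
  rw [entireRiemannXi, entireRiemannXi, completedRiemannZeta₀_one_sub]
  ring

lemma entireRiemannXi_eq_mul_completedRiemannZeta {s : ℂ} (h0 : s ≠ 0) (h1 : s ≠ 1) :
    entireRiemannXi s = s * (s - 1) * completedRiemannZeta s := by
  have h1' : 1 - s ≠ 0 := sub_ne_zero.mpr h1.symm
  rw [entireRiemannXi, completedRiemannZeta_eq]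
  field_simp
  ring

lemma exists_norm_entireRiemannXi_le_of_half_le_re :
    ∃ C : ℝ, 0 ≤ C ∧ ∀ R : ℝ, 1 ≤ R → ∀ z : ℂ, 1 / 2 ≤ z.re → ‖z‖ ≤ R →
      ‖entireRiemannXi z‖ ≤ Real.exp (C * R ^ (3 / 2 : ℝ)) := by
  obtain ⟨K, hK0, hK⟩ := exists_norm_completedRiemannZeta₀_le (1 / 2) 2
  obtain ⟨Z, hZ0, hZ⟩ := exists_norm_completedRiemannZeta_le
  refine ⟨2 * K + Z + 32, by positivity, fun R hR z hre hz ↦ ?_⟩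
  have hRR : R ≤ R ^ (3 / 2 : ℝ) := Real.self_le_rpow_of_one_le hR (by norm_num)
  have hexpR : R ≤ Real.exp R := by linarith [Real.add_one_le_exp R]
  have hz1 : ‖z * (z - 1)‖ ≤ 2 * Real.exp R ^ 2 := by
    have h1 : ‖z - 1‖ ≤ R + 1 := (norm_sub_le _ _).trans (by simpa using hz)
    rw [norm_mul]
    calc ‖z‖ * ‖z - 1‖ ≤ R * (2 * R) := by gcongr; linarith
      _ = 2 * R ^ 2 := by ring
      _ ≤ 2 * Real.exp R ^ 2 := by gcongr
  rcases le_total z.re 2 with h2 | h2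
  · have hΛ := hK z hre h2
    have hE : 1 ≤ Real.exp R ^ 2 := one_le_pow₀ (Real.one_le_exp (by linarith))
    calc ‖entireRiemannXi z‖ ≤ ‖z * (z - 1)‖ * ‖completedRiemannZeta₀ z‖ + 1 := by
          rw [entireRiemannXi, ← norm_mul]
          exact (norm_add_le _ _).trans (by simp)
      _ ≤ 2 * Real.exp R ^ 2 * K + Real.exp R ^ 2 := by gcongr
      _ = (2 * K + 1) * Real.exp R ^ 2 := by ring
      _ ≤ Real.exp (2 * K) * Real.exp R ^ 2 := by gcongr; exact Real.add_one_le_exp _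
      _ = Real.exp (2 * K + 2 * R) := by rw [Real.exp_add, two_mul R, Real.exp_add, sq]
      _ ≤ _ := by
        refine Real.exp_le_exp.mpr ?_
        nlinarith
  · have hΛ := hZ z h2
    have h0 : z ≠ 0 := by rintro rfl; norm_num at h2
    have h1 : z ≠ 1 := by rintro rfl; norm_num at h2
    have hzR : z.re ≤ R := (Complex.re_le_norm z).trans hz
    have hΓ := Real.Gamma_le_exp_rpow (x := z.re / 2) (R := R / 2) (by linarith) (by linarith)
    rw [mul_div_cancel₀ R two_ne_zero] at hΓ
    have hexp1 : (2 : ℝ) ≤ Real.exp 1 := by linarith [Real.add_one_le_exp 1]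
    rw [entireRiemannXi_eq_mul_completedRiemannZeta h0 h1, norm_mul]
    calc ‖z * (z - 1)‖ * ‖completedRiemannZeta z‖
        ≤ (Real.exp 1 * Real.exp R ^ 2) * (Real.exp (8 * R ^ (3 / 2 : ℝ)) * Real.exp Z) := by
          refine mul_le_mul (hz1.trans (by gcongr)) (hΛ.trans ?_) (norm_nonneg _) (by positivity)
          gcongr
          linarith [Real.add_one_le_exp Z]
      _ = Real.exp (1 + 2 * R + 8 * R ^ (3 / 2 : ℝ) + Z) := by
          rw [Real.exp_add, Real.exp_add, Real.exp_add, two_mul R, Real.exp_add, sq]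
          ring
      _ ≤ _ := by
        refine Real.exp_le_exp.mpr ?_
        nlinarith

lemma exists_norm_entireRiemannXi_le :
    ∃ C : ℝ, ∀ R : ℝ, 1 ≤ R → ∀ z : ℂ, ‖z‖ ≤ R →
      ‖entireRiemannXi z‖ ≤ Real.exp (C * R ^ (3 / 2 : ℝ)) := by
  obtain ⟨C, hC0, hC⟩ := exists_norm_entireRiemannXi_le_of_half_le_re
  have h2 : (1 : ℝ) ≤ 2 ^ (3 / 2 : ℝ) := Real.one_le_rpow one_le_two (by norm_num)
  refine ⟨C * 2 ^ (3 / 2 : ℝ), fun R hR z hz ↦ ?_⟩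
  have hR2 : C * 2 ^ (3 / 2 : ℝ) * R ^ (3 / 2 : ℝ) = C * (2 * R) ^ (3 / 2 : ℝ) := by
    rw [Real.mul_rpow two_pos.le (by linarith), mul_assoc]
  rw [hR2]
  rcases le_total (1 / 2) z.re with h | h
  · exact hC _ (by linarith) z h (by linarith)
  · rw [← entireRiemannXi_one_sub]
    refine hC _ (by linarith) _ (by rw [Complex.sub_re, Complex.one_re]; linarith) ?_
    exact (norm_sub_le _ _).trans (by rw [norm_one]; linarith)

lemma logDeriv_entireRiemannXi_zero :
    logDeriv entireRiemannXi 0 =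
      ((1 / 2 * Real.log (4 * π) - 1 - Real.eulerMascheroniConstant / 2 : ℝ) : ℂ) := by
  have hΛ := (differentiable_completedZeta₀ 0).hasDerivAt
  have hd : HasDerivAt entireRiemannXi
      ((1 * (0 - 1) + 0 * 1) * completedRiemannZeta₀ 0 +
        0 * (0 - 1) * deriv completedRiemannZeta₀ 0) 0 :=
    (((hasDerivAt_id (0 : ℂ)).mul ((hasDerivAt_id (0 : ℂ)).sub_const 1)).mul hΛ).add_const 1
  have hlog : Complex.log (4 * π) = (Real.log (4 * π) : ℂ) := by
    rw [Complex.ofReal_log (by positivity)]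
    push_cast
    rfl
  rw [logDeriv_apply, hd.deriv, entireRiemannXi_zero, completedRiemannZeta₀_zero, hlog]
  push_cast
  ring

lemma entireRiemannXi_eq_mul_riemannZeta {s : ℂ} (hs : s ≠ 1)
    (hΓ : Complex.Gamma (s / 2 + 1) ≠ 0) :
    entireRiemannXi s =
      2 * (s - 1) * (π : ℂ) ^ (-s / 2) * Complex.Gamma (s / 2 + 1) * riemannZeta s := by
  have hπ : (π : ℂ) ^ (-s / 2) ≠ 0 := by simp [Complex.cpow_eq_zero_iff, Real.pi_ne_zero]
  have h1 : 1 - s ≠ 0 := sub_ne_zero.mpr hs.symm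
  rw [riemannZeta_eq_mul_completedRiemannZeta₀, entireRiemannXi]
  generalize Complex.Gamma (s / 2 + 1) = G at *
  field_simp
  ring

lemma Complex.Gamma_ne_zero_of_riemannZeta_ne_zero {s : ℂ} (hs : riemannZeta s ≠ 0) :
    Complex.Gamma (s / 2 + 1) ≠ 0 := fun h ↦ by
  rw [riemannZeta_eq_mul_completedRiemannZeta₀, h, mul_zero, div_zero] at hs
  exact hs rfl

lemma logDeriv_entireRiemannXi {s : ℂ} (hs : s ≠ 1) (hζ : riemannZeta s ≠ 0) :
    logDeriv entireRiemannXi s = 1 / (s - 1) - 1 / 2 * (Real.log π : ℂ) +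
      1 / 2 * (deriv Complex.Gamma (s / 2 + 1) / Complex.Gamma (s / 2 + 1)) +
      deriv riemannZeta s / riemannZeta s := by
  have hΓ := Complex.Gamma_ne_zero_of_riemannZeta_ne_zero hζ
  have hΓd : DifferentiableAt ℂ Complex.Gamma (s / 2 + 1) :=
    Complex.differentiableAt_Gamma _ fun m hm ↦ hΓ (hm ▸ Complex.Gamma_neg_nat_eq_zero m)
  have hζd := differentiableAt_riemannZeta hs
  have hπ : (π : ℂ) ^ (-s / 2) ≠ 0 := by simp [Complex.cpow_eq_zero_iff, Real.pi_ne_zero]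
  have h1 : s - 1 ≠ 0 := sub_ne_zero.mpr hs
  have hev : entireRiemannXi =ᶠ[𝓝 s] fun s ↦
      2 * (s - 1) * (π : ℂ) ^ (-s / 2) * Complex.Gamma (s / 2 + 1) * riemannZeta s := by
    filter_upwards [isOpen_ne.mem_nhds hs, hζd.continuousAt.eventually_ne hζ] with z hz1 hz
    exact entireRiemannXi_eq_mul_riemannZeta hz1 (Complex.Gamma_ne_zero_of_riemannZeta_ne_zero hz)
  have hd1 : HasDerivAt (fun s : ℂ ↦ 2 * (s - 1)) (2 * 1) s :=
    ((hasDerivAt_id s).sub_const 1).const_mul 2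
  have hd2 : HasDerivAt (fun s : ℂ ↦ (π : ℂ) ^ (-s / 2))
      ((π : ℂ) ^ (-s / 2) * Complex.log π * (-1 / 2)) s :=
    ((hasDerivAt_id s).neg.div_const 2).const_cpow (Or.inl (by simp [Real.pi_ne_zero]))
  have hd3 : HasDerivAt (fun s : ℂ ↦ Complex.Gamma (s / 2 + 1))
      (deriv Complex.Gamma (s / 2 + 1) * (1 / 2)) s :=
    hΓd.hasDerivAt.comp s (((hasDerivAt_id s).div_const 2).add_const 1)
  rw [logDeriv_apply, hev.deriv_eq, hev.eq_of_nhds,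
    (((hd1.fun_mul hd2).fun_mul hd3).fun_mul hζd.hasDerivAt).deriv, Complex.ofReal_log Real.pi_pos.le]
  clear hev hd1 hd2 hd3 hΓd
  generalize deriv Complex.Gamma (s / 2 + 1) = G', Complex.Gamma (s / 2 + 1) = G at *
  field_simp
  ring

lemma entireRiemannXi_eq_zero_iff {s : ℂ} :
    entireRiemannXi s = 0 ↔ riemannZeta s = 0 ∧ 0 < s.re ∧ s.re < 1 := by
  have key : ∀ {z : ℂ}, 0 < z.re → (entireRiemannXi z = 0 ↔ z ≠ 1 ∧ riemannZeta z = 0) := by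
    intro z hz
    rcases eq_or_ne z 1 with rfl | h1
    · simp
    have hΓ : Complex.Gamma (z / 2 + 1) ≠ 0 :=
      Complex.Gamma_ne_zero_of_re_pos (by simp; linarith)
    have hπ : (π : ℂ) ^ (-z / 2) ≠ 0 := by simp [Complex.cpow_eq_zero_iff, Real.pi_ne_zero]
    rw [entireRiemannXi_eq_mul_riemannZeta h1 hΓ]
    simp [h1, hΓ, hπ, sub_ne_zero]
  have hlt : ∀ {z : ℂ}, 0 < z.re → entireRiemannXi z = 0 → z.re < 1 := by
    intro z hz h
    by_contra! h1
    exact riemannZeta_ne_zero_of_one_le_re h1 ((key hz).mp h).2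
  refine ⟨fun h ↦ ?_, fun ⟨h, h0, h1⟩ ↦ (key h0).mpr ⟨by rintro rfl; simp at h1, h⟩⟩
  have h0 : 0 < s.re := by
    by_contra! h0
    have := hlt (z := 1 - s) (by simp; linarith) (by rw [entireRiemannXi_one_sub, h])
    simp at this
    linarith
  exact ⟨((key h0).mp h).2, h0, hlt h0 h⟩

lemma zetaZeroMultiplicity_eq_analyticOrderNatAt {ρ : ℂ} (h0 : 0 < ρ.re) (h1 : ρ.re < 1) :
    zetaZeroMultiplicity ρ = analyticOrderNatAt entireRiemannXi ρ := by
  have hne : ρ ≠ 1 := by rintro rfl; simp at h1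
  have hζ : AnalyticAt ℂ riemannZeta ρ := analyticOn_riemannZeta ρ hne
  let u : ℂ → ℂ := fun s ↦ 2 * (s - 1) * (π : ℂ) ^ (-s / 2) * Complex.Gamma (s / 2 + 1)
  have hopen : IsOpen {s : ℂ | 0 < s.re ∧ s.re < 1} :=
    (isOpen_lt continuous_const Complex.continuous_re).inter
      (isOpen_lt Complex.continuous_re continuous_const)
  have hre : ∀ {s : ℂ}, 0 < s.re → 0 < (s / 2 + 1).re := fun hs ↦ by simp; linarith
  have hud : DifferentiableOn ℂ u {s : ℂ | 0 < s.re ∧ s.re < 1} := fun s hs ↦ by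
    have hΓ : DifferentiableAt ℂ Complex.Gamma (s / 2 + 1) :=
      Complex.differentiableAt_Gamma _ fun m hm ↦
        Complex.Gamma_ne_zero_of_re_pos (hre hs.1) (hm ▸ Complex.Gamma_neg_nat_eq_zero m)
    have hΓ' : DifferentiableAt ℂ (fun s : ℂ ↦ Complex.Gamma (s / 2 + 1)) s :=
      hΓ.comp s (by fun_prop)
    have hπ : DifferentiableAt ℂ (fun s : ℂ ↦ (π : ℂ) ^ (-s / 2)) s :=
      DifferentiableAt.const_cpow (by fun_prop) (Or.inl (by simp [Real.pi_ne_zero]))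
    exact DifferentiableAt.differentiableWithinAt (by fun_prop)
  have hu : AnalyticAt ℂ u ρ := hud.analyticAt (hopen.mem_nhds ⟨h0, h1⟩)
  have hu0 : u ρ ≠ 0 := by
    simp [u, Complex.cpow_eq_zero_iff, Real.pi_ne_zero, sub_ne_zero, hne,
      Complex.Gamma_ne_zero_of_re_pos (hre h0)]
  have hev : entireRiemannXi =ᶠ[𝓝 ρ] u * riemannZeta := by
    filter_upwards [hopen.mem_nhds ⟨h0, h1⟩] with s hs
    exact entireRiemannXi_eq_mul_riemannZeta (by rintro rfl; simp at hs)
      (Complex.Gamma_ne_zero_of_re_pos (hre hs.1))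
  have horder : analyticOrderAt entireRiemannXi ρ = analyticOrderAt riemannZeta ρ := by
    rw [analyticOrderAt_congr hev, analyticOrderAt_mul hu hζ, hu.analyticOrderAt_eq_zero.mpr hu0,
      zero_add]
  have htop : analyticOrderAt entireRiemannXi ρ ≠ ⊤ := by
    intro h
    have := (AnalyticOnNhd.eqOn_zero_of_preconnected_of_eventuallyEq_zero
      (fun z _ ↦ differentiable_entireRiemannXi.analyticAt z) isPreconnected_univ (mem_univ ρ)
      (analyticOrderAt_eq_top.mp h)) (mem_univ 0)
    simp at this
  have hnat : analyticOrderAt riemannZeta ρ = (analyticOrderNatAt entireRiemannXi ρ : ℕ∞) := by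
    rw [← horder, Nat.cast_analyticOrderNatAt htop]
  obtain ⟨hlt, hn⟩ := (analyticOrderAt_eq_nat_iff_iteratedDeriv_eq_zero hζ).mp hnat
  refine le_antisymm (Nat.sInf_le hn) (le_csInf ⟨_, hn⟩ fun m hm ↦ ?_)
  by_contra! h
  exact hm (hlt m h)

end RiemannXi

/-- **Hadamard explicit formula for `ζ'/ζ`**: for `s ≠ 1` with `ζ(s) ≠ 0`, the family
`(m_ρ (1/(s-ρ) + 1/ρ))_ρ` indexed by the nontrivial zeros `ρ` of `ζ` (with
multiplicities `m_ρ`) is summable, and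
`ζ'(s)/ζ(s) = B - 1/(s-1) + (1/2) log π - (1/2) (Γ'/Γ)(s/2 + 1) + Σ_ρ m_ρ (1/(s-ρ) + 1/ρ)`
where `B = (1/2) log (4π) - 1 - γ/2`. -/
theorem hadamard_explicit_formula_zeta_logDeriv (s : ℂ) (hs1 : s ≠ 1)
    (hs0 : riemannZeta s ≠ 0) :
    Summable (fun ρ : {ρ : ℂ // riemannZeta ρ = 0 ∧ 0 < ρ.re ∧ ρ.re < 1} =>
      (zetaZeroMultiplicity ρ.1 : ℂ) * (1 / (s - ρ.1) + 1 / ρ.1)) ∧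
    deriv riemannZeta s / riemannZeta s =
      ((1 / 2 * Real.log (4 * π) - 1 - Real.eulerMascheroniConstant / 2 : ℝ) : ℂ)
        - 1 / (s - 1) + 1 / 2 * (Real.log π : ℂ)
        - 1 / 2 * (deriv Complex.Gamma (s / 2 + 1) / Complex.Gamma (s / 2 + 1))
        + ∑' ρ : {ρ : ℂ // riemannZeta ρ = 0 ∧ 0 < ρ.re ∧ ρ.re < 1},
            (zetaZeroMultiplicity ρ.1 : ℂ) * (1 / (s - ρ.1) + 1 / ρ.1) := by
  obtain ⟨C, hC⟩ := exists_norm_entireRiemannXi_le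
  have hs : entireRiemannXi s ≠ 0 := fun h ↦ hs0 (entireRiemannXi_eq_zero_iff.mp h).1
  have hsum := differentiable_entireRiemannXi.hasSum_logDeriv_sub entireRiemannXi_zero
    (by norm_num) hC hs
  rw [logDeriv_entireRiemannXi_zero, logDeriv_entireRiemannXi hs1 hs0,
    ← (Equiv.subtypeEquivRight fun _ ↦ entireRiemannXi_eq_zero_iff.symm).hasSum_iff] at hsum
  have hmult : (fun ρ : {ρ : ℂ // riemannZeta ρ = 0 ∧ 0 < ρ.re ∧ ρ.re < 1} ↦
      (zetaZeroMultiplicity ρ.1 : ℂ) * (1 / (s - ρ.1) + 1 / ρ.1)) =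
      (fun ρ : {ρ : ℂ // entireRiemannXi ρ = 0} ↦ (analyticOrderNatAt entireRiemannXi ρ : ℂ) *
        (1 / (s - ρ) + 1 / ρ)) ∘
          Equiv.subtypeEquivRight fun _ ↦ entireRiemannXi_eq_zero_iff.symm := by
    funext ρ
    rw [zetaZeroMultiplicity_eq_analyticOrderNatAt ρ.2.2.1 ρ.2.2.2]
    rfl
  rw [← hmult] at hsum
  refine ⟨hsum.summable, ?_⟩
  rw [hsum.tsum_eq]
  ring
end
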